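/- arXiv:1306.6170 — 9 statements merged into one kernel-verified Lean document; each statement's English description precedes it below -/
import Mathlib

section
/- Let n ≥ 1 and let T ∈ ℂ[X] be a polynomial of degree n with leading coefficient τ ≠ 0. Then there exist a natural number ℓ with 1 ≤ ℓ ≤ n, a monic squarefree polynomial H ∈ ℂ[X] of degree 2ℓ (i.e. H = ∏_{j=1}^{2ℓ}(X - a_j) with pairwise distinct a_1, …, a_{2ℓ} ∈ ℂ), and a polynomial U ∈ ℂ[X] of degree n − ℓ with leading coefficient τ, such that T² − 1 = H · U². -/
open Polynomial

theorem WfDvdMonoid.exists_squarefree_mul_sq {M : Type*} [CommMonoidWithZero M]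
    [WfDvdMonoid M] (a : M) (ha : a ≠ 0) :
    ∃ s v : M, Squarefree s ∧ a = s * v ^ 2 := by
  induction a using (wellFounded_dvdNotUnit (α := M)).induction with
  | _ a ih =>
    by_cases h : Squarefree a
    · exact ⟨a, 1, h, by simp⟩
    · simp only [Squarefree, not_forall] at h
      obtain ⟨x, ⟨b, rfl⟩, hx⟩ := h
      have hb : b ≠ 0 := right_ne_zero_of_mul ha
      obtain ⟨s, v, hs, rfl⟩ := ih b
        ⟨hb, x * x, fun h => hx (isUnit_of_mul_isUnit_left h), mul_comm _ _⟩ hb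
      exact ⟨s, x * v, hs, by rw [mul_pow, pow_two x]; exact mul_left_comm _ _ _⟩

theorem Polynomial.natDegree_eq_zero_of_sq_sub_one_eq_sq {T U : ℂ[X]}
    (h : T ^ 2 - 1 = U ^ 2) : T.natDegree = 0 := by
  have h1 : (T - U) * (T + U) = 1 := by linear_combination h
  have hm := natDegree_eq_zero_of_isUnit (IsUnit.of_mul_eq_one _ h1)
  have hp := natDegree_eq_zero_of_isUnit (IsUnit.of_mul_eq_one_right _ h1)
  have h2 : (C 2 * T).natDegree = 0 := by
    have h3 : C 2 * T = (T - U) + (T + U) := by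
      rw [C_ofNat]; ring
    have := natDegree_add_le (T - U) (T + U)
    rw [h3]
    omega
  rwa [natDegree_C_mul two_ne_zero] at h2

theorem stmt_0 (n : ℕ) (hn : 1 ≤ n) (T : Polynomial ℂ) (τ : ℂ) (hτ : τ ≠ 0)
    (hdeg : T.natDegree = n) (hlc : T.leadingCoeff = τ) :
    ∃ ℓ : ℕ, 1 ≤ ℓ ∧ ℓ ≤ n ∧
      ∃ H U : Polynomial ℂ, H.Monic ∧ Squarefree H ∧ H.natDegree = 2 * ℓ ∧
        U.natDegree = n - ℓ ∧ U.leadingCoeff = τ ∧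
        T ^ 2 - 1 = H * U ^ 2 := by
  have hlt : (1 : ℂ[X]).natDegree < (T ^ 2).natDegree := by
    rw [natDegree_one, natDegree_pow]; omega
  have hPdeg : (T ^ 2 - 1).natDegree = 2 * n := by
    rw [natDegree_sub_eq_left_of_natDegree_lt hlt, natDegree_pow, hdeg]
  have hPlc : (T ^ 2 - 1).leadingCoeff = τ ^ 2 := by
    rw [leadingCoeff_sub_of_degree_lt (degree_lt_degree hlt), leadingCoeff_pow, hlc]
  have hP0 : T ^ 2 - 1 ≠ 0 := by
    rw [← leadingCoeff_ne_zero, hPlc]; exact pow_ne_zero 2 hτ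
  obtain ⟨S, V, hS, hSV⟩ := WfDvdMonoid.exists_squarefree_mul_sq _ hP0
  have hs : S.leadingCoeff ≠ 0 := leadingCoeff_ne_zero.2 hS.ne_zero
  have hv : V.leadingCoeff ≠ 0 := by
    rw [leadingCoeff_ne_zero]
    rintro rfl
    simp [hSV] at hP0
  have hlcSV : τ ^ 2 = S.leadingCoeff * V.leadingCoeff ^ 2 := by
    rw [← hPlc, hSV, leadingCoeff_mul, leadingCoeff_pow]
  have hdegSV : 2 * n = S.natDegree + 2 * V.natDegree := by
    rw [← hPdeg, hSV, natDegree_mul hS.ne_zero (pow_ne_zero 2 (leadingCoeff_ne_zero.1 hv)),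
      natDegree_pow]
  have hHU : T ^ 2 - 1 =
      (C S.leadingCoeff⁻¹ * S) * (C (τ / V.leadingCoeff) * V) ^ 2 := by
    have hc : S.leadingCoeff⁻¹ * (τ / V.leadingCoeff) ^ 2 = 1 := by
      rw [div_pow, hlcSV]; field_simp
    have hC : C S.leadingCoeff⁻¹ * C (τ / V.leadingCoeff) ^ 2 = 1 := by
      rw [← C_pow, ← C_mul, hc, C_1]
    rw [hSV]
    linear_combination (-(S * V ^ 2)) * hC
  have hH : (C S.leadingCoeff⁻¹ * S).Monic := by
    rw [Monic, leadingCoeff_mul, leadingCoeff_C, inv_mul_cancel₀ hs]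
  have hHdeg : (C S.leadingCoeff⁻¹ * S).natDegree = S.natDegree :=
    natDegree_C_mul (inv_ne_zero hs)
  have hpos : S.natDegree ≠ 0 := by
    intro h0
    rw [hH.natDegree_eq_zero.1 (hHdeg.trans h0), one_mul] at hHU
    have := natDegree_eq_zero_of_sq_sub_one_eq_sq hHU
    omega
  refine ⟨n - V.natDegree, by omega, by omega, _, _, hH, ?_, by omega, ?_, ?_, hHU⟩
  · have hu : IsUnit (C S.leadingCoeff⁻¹) := isUnit_C.2 (inv_ne_zero hs).isUnit
    exact hS.squarefree_of_dvd (hu.mul_left_dvd.2 dvd_rfl)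
  · rw [natDegree_C_mul (div_ne_zero hτ hv)]
    omega
  · rw [leadingCoeff_mul, leadingCoeff_C, div_mul_cancel₀ _ hv]
end

section
/- Let n ≥ 1 and let T ∈ ℂ[X] have degree n. Define the inverse image S := {z ∈ ℂ : T(z) ∈ [−1, 1]}, where [−1, 1] is regarded as the set of complex numbers with real part in [−1, 1] and imaginary part 0. Then S is connected if and only if every root of the derivative T′ lies in S. -/
open Polynomial

open Set Metric Topology

theorem IsPreconnected.preimage_of_fiber_subset {X Y : Type*} [TopologicalSpace X]
    [TopologicalSpace Y] {f : X → Y} (hopen : IsOpenMap f) (hclosed : IsClosedMap f)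
    {K : Set Y} (hK : IsPreconnected K) {y : Y} (hy : y ∈ K) {P : Set X}
    (hP : IsPreconnected P) (hfib : f ⁻¹' {y} ⊆ P) (hPK : P ⊆ f ⁻¹' K) :
    IsPreconnected (f ⁻¹' K) := by
  have : PreconnectedSpace K := isPreconnected_iff_preconnectedSpace.1 hK
  rw [isPreconnected_iff_preconnectedSpace, preconnectedSpace_iff_clopen]
  have key (s : Set (f ⁻¹' K)) (hs : IsClopen s) (hne : s.Nonempty) :
      ∃ x ∈ s, f x = y := by
    have himg : K.restrictPreimage f '' s = univ :=
      IsClopen.eq_univ ⟨hclosed.restrictPreimage K _ hs.1, hopen.restrictPreimage K _ hs.2⟩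
        (hne.image _)
    obtain ⟨x, hx, hxy⟩ : (⟨y, hy⟩ : K) ∈ K.restrictPreimage f '' s := himg ▸ mem_univ _
    exact ⟨x, hx, congrArg Subtype.val hxy⟩
  intro s hs
  by_contra! h
  obtain ⟨a, has, ha⟩ := key s hs h.1
  obtain ⟨b, hbs, hb⟩ := key sᶜ hs.compl (nonempty_compl.2 h.2)
  have hP' : IsPreconnected ((↑) ⁻¹' P : Set (f ⁻¹' K)) := by
    rw [← IsInducing.subtypeVal.isPreconnected_image, Subtype.image_preimage_coe,
      inter_eq_right.2 hPK]
    exact hP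
  exact hbs (hP'.subset_isClopen hs ⟨a, hfib ha, has⟩ (hfib hb))

theorem IsPreconnected.iInter_of_directed_isCompact {X ι : Type*} [TopologicalSpace X] [T2Space X]
    [Nonempty ι] {V : ι → Set X} (hV : Directed (· ⊇ ·) V) (hcomp : ∀ i, IsCompact (V i))
    (hconn : ∀ i, IsPreconnected (V i)) : IsPreconnected (⋂ i, V i) := by
  have hc : IsCompact (⋂ i, V i) := (hcomp (Classical.arbitrary ι)).of_isClosed_subset
    (isClosed_iInter fun i ↦ (hcomp i).isClosed) (iInter_subset V _)
  rw [isPreconnected_iff_subset_of_fully_disjoint_closed hc.isClosed]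
  intro u v hu hv huv hd
  obtain ⟨U, W, hU, hW, huU, hvW, hUW⟩ := SeparatedNhds.of_isCompact_isCompact
    (hc.inter_right hu) (hc.inter_right hv) (hd.mono inter_subset_right inter_subset_right)
  obtain ⟨i, hi⟩ := exists_subset_nhds_of_isCompact (U := U ∪ W) hV hcomp fun x hx ↦
    (hU.union hW).mem_nhds <| (huv hx).imp (fun h ↦ huU ⟨hx, h⟩) (fun h ↦ hvW ⟨hx, h⟩)
  have hsub := iInter_subset V i
  rcases (hconn i).subset_or_subset hU hW hUW hi with h | h
  · refine .inl fun x hx ↦ (huv hx).resolve_right fun hxv ↦ ?_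
    exact hUW.le_bot ⟨h (hsub hx), hvW ⟨hx, hxv⟩⟩
  · refine .inr fun x hx ↦ (huv hx).resolve_left fun hxu ↦ ?_
    exact hUW.le_bot ⟨huU ⟨hx, hxu⟩, h (hsub hx)⟩

theorem Convex.isPreconnected_preimage_of_closure {X E : Type*} [TopologicalSpace X]
    [NormedAddCommGroup E] [NormedSpace ℝ E] {f : X → E} (hf : Continuous f) (hopen : IsOpenMap f)
    {U : Set E} (hU : IsOpen U) (hconv : Convex ℝ U) (hconn : IsPreconnected (f ⁻¹' closure U))
    (hloc : ∀ x, f x ∈ frontier U → ∃ e : OpenPartialHomeomorph X E, x ∈ e.source ∧ ⇑e = f) :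
    IsPreconnected (f ⁻¹' U) := by
  have hO : IsOpen (f ⁻¹' U) := hU.preimage hf
  rw [isPreconnected_iff_subset_of_disjoint]
  by_contra! ⟨u, v, hu, hv, huv, hd, hnu, hnv⟩
  obtain ⟨a, ha, hau⟩ := not_subset.1 hnu
  obtain ⟨b, hb, hbv⟩ := not_subset.1 hnv
  have hdisj {w : X} (hw : w ∈ f ⁻¹' U) (h₁ : w ∈ u) (h₂ : w ∈ v) : False :=
    (hd ▸ (⟨hw, h₁, h₂⟩ : w ∈ f ⁻¹' U ∩ (u ∩ v)) : w ∈ (∅ : Set X))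
  have hcover : f ⁻¹' closure U ⊆ closure (f ⁻¹' U ∩ u) ∪ closure (f ⁻¹' U ∩ v) := by
    rw [← closure_union, ← inter_union_distrib_left, inter_eq_left.2 huv]
    exact hopen.preimage_closure_subset_closure_preimage
  obtain ⟨z, hz, hzu, hzv⟩ := isPreconnected_closed_iff.1 hconn _ _ isClosed_closure
    isClosed_closure hcover
    ⟨b, subset_closure hb, subset_closure ⟨hb, (huv hb).resolve_right hbv⟩⟩
    ⟨a, subset_closure ha, subset_closure ⟨ha, (huv ha).resolve_left hau⟩⟩
  by_cases hzU : z ∈ f ⁻¹' U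
  · rcases huv hzU with h | h
    · obtain ⟨w, hw, hw'⟩ := mem_closure_iff.1 hzv _ (hO.inter hu) ⟨hzU, h⟩
      exact hdisj hw.1 hw.2 hw'.2
    · obtain ⟨w, hw, hw'⟩ := mem_closure_iff.1 hzu _ (hO.inter hv) ⟨hzU, h⟩
      exact hdisj hw.1 hw'.2 hw.2
  obtain ⟨e, hze, rfl⟩ := hloc z (hU.frontier_eq ▸ ⟨hz, hzU⟩)
  obtain ⟨r, hr, hball⟩ := Metric.isOpen_iff.1 e.open_target _ (e.map_source hze)
  have hN : IsPreconnected (e.symm '' (ball (e z) r ∩ U)) :=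
    ((convex_ball _ _).inter hconv).isPreconnected.image _
      (e.continuousOn_symm.mono (inter_subset_left.trans hball))
  have hopenN : IsOpen (e.source ∩ e ⁻¹' ball (e z) r) := e.isOpen_inter_preimage isOpen_ball
  have hzN : z ∈ e.source ∩ e ⁻¹' ball (e z) r := ⟨hze, mem_ball_self hr⟩
  have hmemN {w : X} (hw : w ∈ e.source ∩ e ⁻¹' ball (e z) r) (hwU : w ∈ e ⁻¹' U) :
      w ∈ e.symm '' (ball (e z) r ∩ U) := ⟨e w, ⟨hw.2, hwU⟩, e.left_inv hw.1⟩
  have hNU : e.symm '' (ball (e z) r ∩ U) ⊆ e ⁻¹' U := by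
    rintro _ ⟨w, hw, rfl⟩
    simpa [e.right_inv (hball hw.1)] using hw.2
  obtain ⟨p, hp, hp'⟩ := mem_closure_iff.1 hzu _ hopenN hzN
  obtain ⟨q, hq, hq'⟩ := mem_closure_iff.1 hzv _ hopenN hzN
  obtain ⟨w, hw, hwu, hwv⟩ := hN u v hu hv (hNU.trans huv) ⟨p, hmemN hp hp'.1, hp'.2⟩
    ⟨q, hmemN hq hq'.1, hq'.2⟩
  exact hdisj (hNU hw) hwu hwv

theorem Polynomial.isPreconnected_preimage_of_convex {T : ℂ[X]} (hT : T.natDegree ≠ 0)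
    {I : Set ℂ} (hI : IsCompact I) (hne : I.Nonempty) (hconv : Convex ℝ I)
    (hcrit : ∀ z, T.derivative.IsRoot z → T.eval z ∈ I) :
    IsPreconnected (T.eval ⁻¹' I) := by
  have hcont : Continuous T.eval := T.continuous
  have hproper : IsProperMap T.eval :=
    T.isProperMap_eval (natDegree_pos_iff_degree_pos.1 (Nat.pos_of_ne_zero hT))
  have hopen : IsOpenMap T.eval := (T.isOpenQuotientMap_eval hT).isOpenMap
  have hclosed : IsClosedMap T.eval := hproper.isClosedMap
  obtain ⟨y, hy⟩ := hne
  have hfin : (T.eval ⁻¹' {y}).Finite := by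
    rw [preimage_eval_singleton (by rintro rfl; simp at hT)]
    exact rootSet_finite ..
  have hfibne : (T.eval ⁻¹' {y}).Nonempty := (T.isOpenQuotientMap_eval hT).surjective y
  have hyth (δ : ℝ) : y ∈ cthickening δ I := self_subset_cthickening I hy
  have hmem {δ : ℝ} (hδ : 0 ≤ δ) {w : ℂ} : w ∈ cthickening δ I ↔ infDist w I ≤ δ := by
    rw [mem_cthickening_iff, infDist, ENNReal.le_ofReal_iff_toReal_le (infEDist_ne_top ⟨y, hy⟩) hδ]
  have hsupset {δ : ℝ} {P : Set ℂ} (hP : IsPreconnected P) (hfib : T.eval ⁻¹' {y} ⊆ P)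
      (hPK : P ⊆ T.eval ⁻¹' cthickening δ I) : IsPreconnected (T.eval ⁻¹' cthickening δ I) :=
    (hconv.cthickening δ).isPreconnected.preimage_of_fiber_subset hopen hclosed (hyth δ) hP hfib hPK
  have hcompact {P : Set ℂ} (hPc : IsCompact P) (hP : IsPreconnected P)
      (hfib : T.eval ⁻¹' {y} ⊆ P) :
      ∃ x ∈ P, IsPreconnected (T.eval ⁻¹' cthickening (infDist (T.eval x) I) I) := by
    obtain ⟨x, hx, hmax⟩ := hPc.exists_isMaxOn (hfibne.mono hfib)
      ((continuous_infDist_pt I).comp hcont).continuousOn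
    exact ⟨x, hx, hsupset hP hfib fun w hw ↦ (hmem infDist_nonneg).2 (hmax hw)⟩
  set J := {δ : ℝ | 0 ≤ δ ∧ IsPreconnected (T.eval ⁻¹' cthickening δ I)}
  have hJne : J.Nonempty := by
    obtain ⟨r, hr⟩ := hfin.isBounded.subset_closedBall 0
    obtain ⟨x, -, hx⟩ := hcompact (isCompact_closedBall 0 r)
      (convex_closedBall (0 : ℂ) r).isPreconnected hr
    exact ⟨_, infDist_nonneg, hx⟩
  have hJbdd : BddBelow J := ⟨0, fun _ h ↦ h.1⟩
  have hinf : 0 ≤ sInf J := Real.sInf_nonneg fun _ h ↦ h.1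
  have hconn : IsPreconnected (T.eval ⁻¹' cthickening (sInf J) I) := by
    rw [cthickening_eq_iInter_cthickening, ← iInter_subtype (fun ε ↦ sInf J < ε)
      (fun ε ↦ cthickening ε.1 I), preimage_iInter]
    have : Nonempty {ε // sInf J < ε} := ⟨⟨_, lt_add_one _⟩⟩
    refine IsPreconnected.iInter_of_directed_isCompact ?_ (fun ε ↦ ?_) fun ⟨ε, hε⟩ ↦ ?_
    · exact Monotone.directed_ge fun a b hab ↦ preimage_mono (cthickening_mono hab I)
    · exact hproper.isCompact_preimage hI.cthickening
    · obtain ⟨δ, hδ, hlt⟩ := exists_lt_of_csInf_lt hJne hε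
      exact hsupset hδ.2 (preimage_mono (singleton_subset_iff.2 (hyth δ)))
        (preimage_mono (cthickening_mono hlt.le I))
  rcases hinf.eq_or_lt with h0 | hpos
  · rwa [← h0, cthickening_zero, hI.isClosed.closure_eq] at hconn
  have hconnO : IsPreconnected (T.eval ⁻¹' thickening (sInf J) I) := by
    refine (hconv.thickening _).isPreconnected_preimage_of_closure hcont hopen isOpen_thickening
      ?_ fun z hz ↦ ?_
    · rwa [closure_thickening hpos]
    · have hz' : T.derivative.eval z ≠ 0 := fun h ↦
        (isOpen_thickening.frontier_eq (X := ℂ) ▸ hz).2 (self_subset_thickening hpos I (hcrit z h))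
      exact ⟨_, ((T.hasStrictDerivAt z).hasStrictFDerivAt_equiv hz').mem_toOpenPartialHomeomorph_source,
        by simp⟩
  have hfibO : T.eval ⁻¹' {y} ⊆ T.eval ⁻¹' thickening (sInf J) I :=
    preimage_mono (singleton_subset_iff.2 (self_subset_thickening hpos I hy))
  have hpath : IsPathConnected (T.eval ⁻¹' thickening (sInf J) I) :=
    (isOpen_thickening.preimage hcont).isConnected_iff_isPathConnected.1
      ⟨hfibne.mono hfibO, hconnO⟩
  obtain ⟨_ | k, p, hp⟩ := hfin.fin_embedding
  · simp [← hp] at hfibne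
  obtain ⟨γ, hγ, hpγ⟩ := hpath.exists_path_through_family p fun i ↦ hfibO (hp ▸ mem_range_self i)
  obtain ⟨x, hx, hxconn⟩ := hcompact (isCompact_range γ.continuous)
    (isPreconnected_range γ.continuous) (hp ▸ range_subset_iff.2 hpγ)
  exact absurd (csInf_le hJbdd ⟨infDist_nonneg, hxconn⟩)
    (not_le.2 ((mem_thickening_iff_infDist_lt ⟨y, hy⟩).1 (hγ hx)))

/-- Functions vanishing off `X` whose restriction to `X` is locally constant. -/
def locallyConstantOn {α : Type*} [TopologicalSpace α] (X : Set α) : Submodule ℝ (α → ℝ) where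
  carrier := {g | (∀ z ∉ X, g z = 0) ∧ ∀ z ∈ X, ∀ᶠ w in 𝓝[X] z, g w = g z}
  add_mem' := fun hg hh ↦ ⟨fun z hz ↦ by simp [hg.1 z hz, hh.1 z hz], fun z hz ↦ by
    filter_upwards [hg.2 z hz, hh.2 z hz] with w h₁ h₂ using by simp [h₁, h₂]⟩
  zero_mem' := by simp
  smul_mem' := fun c g hg ↦ ⟨fun z hz ↦ by simp [hg.1 z hz], fun z hz ↦ by
    filter_upwards [hg.2 z hz] with w h₁ using by simp [h₁]⟩

theorem IsPreconnected.rank_locallyConstantOn_le_one {α : Type*} [TopologicalSpace α] {X : Set α}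
    (hX : IsPreconnected X) : Module.rank ℝ (locallyConstantOn X) ≤ 1 := by
  rcases X.eq_empty_or_nonempty with rfl | ⟨x, hx⟩
  · have : Subsingleton (locallyConstantOn (∅ : Set α)) :=
      subsingleton_of_forall_eq 0 fun g ↦ Subtype.ext <| funext fun z ↦ g.2.1 z (notMem_empty z)
    simp
  have := isPreconnected_iff_preconnectedSpace.1 hX
  suffices h : Function.Injective ((LinearMap.proj x).comp (locallyConstantOn X).subtype) by
    simpa using LinearMap.lift_rank_le_of_injective _ h
  refine (injective_iff_map_eq_zero _).2 fun g hg ↦ Subtype.ext <| funext fun z ↦ ?_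
  by_cases hz : z ∈ X
  · have hloc : IsLocallyConstant (X.domRestrict g.1) :=
      (IsLocallyConstant.iff_eventually_eq _).2 fun y ↦
        (eventually_nhds_subtype_iff X y fun w ↦ g.1 w = g.1 y).2 (g.2.2 y y.2)
    exact (hloc.apply_eq_of_preconnectedSpace ⟨z, hz⟩ ⟨x, hx⟩).trans hg
  · exact g.2.1 z hz

theorem card_le_rank_locallyConstantOn {α : Type*} [TopologicalSpace α] {X : Set α} {F : Finset α}
    (hF : F.Nonempty) (hFX : ↑F ⊆ X) {U : α → Set α} (hU : ∀ z, z ∈ U z ∧ IsOpen (U z))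
    (hd : (F : Set α).PairwiseDisjoint U) (hcover : X ⊆ ⋃ z ∈ F, U z) :
    (F.card : Cardinal) ≤ Module.rank ℝ (locallyConstantOn X) := by
  have : Nonempty F := hF.to_subtype
  have hex (w : α) : ∃ z : F, w ∈ X → w ∈ U z := by
    by_cases hw : w ∈ X
    · obtain ⟨z, hz, hwz⟩ := mem_iUnion₂.1 (hcover hw)
      exact ⟨⟨z, hz⟩, fun _ ↦ hwz⟩
    · exact ⟨Classical.arbitrary F, fun h ↦ absurd h hw⟩
  choose c hc using hex
  have hceq {w : α} {z : F} (hw : w ∈ X) (hwz : w ∈ U z) : c w = z :=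
    Subtype.ext <| hd.elim_set (c w).2 z.2 w (hc w hw) hwz
  let φ : (F → ℝ) →ₗ[ℝ] locallyConstantOn X :=
    { toFun := fun u ↦ ⟨X.indicator (u ∘ c), fun z hz ↦ indicator_of_notMem hz _, fun z hz ↦ by
        filter_upwards [self_mem_nhdsWithin,
          mem_nhdsWithin_of_mem_nhds ((hU (c z)).2.mem_nhds (hc z hz))] with w hw hwz
        simp [hw, hz, hceq hw hwz]⟩
      map_add' := fun u v ↦ Subtype.ext (indicator_add X (u ∘ c) (v ∘ c))
      map_smul' := fun r u ↦ Subtype.ext (indicator_const_smul X r (u ∘ c)) }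
  have hφ : Function.Injective φ := (injective_iff_map_eq_zero _).2 fun u hu ↦ funext fun z ↦ by
    have := congrFun (congrArg Subtype.val hu) z
    simpa [φ, hFX z.2, hceq (hFX z.2) (hU z).1] using this
  simpa using LinearMap.rank_le_of_injective φ hφ

open Classical in
theorem rank_locallyConstantOn_add_le {α : Type*} [TopologicalSpace α] {X Y : Set α}
    (hX : IsClosed X) (hY : IsClosed Y) {F : Finset α} (hF : X ∩ Y = F) :
    Module.rank ℝ (locallyConstantOn X) + Module.rank ℝ (locallyConstantOn Y) ≤
      Module.rank ℝ (locallyConstantOn (X ∪ Y)) + F.card := by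
  let D : (locallyConstantOn X × locallyConstantOn Y) →ₗ[ℝ] (F → ℝ) :=
    { toFun := fun p z ↦ p.1.1 z - p.2.1 z
      map_add' := fun p q ↦ by ext; simp; ring
      map_smul' := fun r p ↦ by ext; simp; ring }
  have hker {p} (hp : p ∈ D.ker) {z : α} (hzX : z ∈ X) (hzY : z ∈ Y) : p.1.1 z = p.2.1 z :=
    sub_eq_zero.1 (congrFun (LinearMap.mem_ker.1 hp) ⟨z, by
      rw [← Finset.mem_coe, ← hF]; exact ⟨hzX, hzY⟩⟩)
  have hright {p} (hp : p ∈ D.ker) {z : α} (hzY : z ∈ Y) : X.piecewise p.1.1 p.2.1 z = p.2.1 z := by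
    by_cases hzX : z ∈ X
    · rw [piecewise_eq_of_mem _ _ _ hzX, hker hp hzX hzY]
    · rw [piecewise_eq_of_notMem _ _ _ hzX]
  have hmem {p} (hp : p ∈ D.ker) : X.piecewise p.1.1 p.2.1 ∈ locallyConstantOn (X ∪ Y) := by
    refine ⟨fun z hz ↦ ?_, fun z _ ↦ ?_⟩
    · rw [mem_union, not_or] at hz
      rw [piecewise_eq_of_notMem _ _ _ hz.1, p.2.2.1 z hz.2]
    · rw [nhdsWithin_union, Filter.eventually_sup]
      constructor
      · by_cases hzX : z ∈ X
        · filter_upwards [self_mem_nhdsWithin, p.1.2.2 z hzX] with w hw h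
          rw [piecewise_eq_of_mem _ _ _ hzX, piecewise_eq_of_mem _ _ _ hw, h]
        · filter_upwards [self_mem_nhdsWithin,
            mem_nhdsWithin_of_mem_nhds (hX.isOpen_compl.mem_nhds hzX)] with w h h' using absurd h h'
      · by_cases hzY : z ∈ Y
        · filter_upwards [self_mem_nhdsWithin, p.2.2.2 z hzY] with w hw h
          rw [hright hp hzY, hright hp hw, h]
        · filter_upwards [self_mem_nhdsWithin,
            mem_nhdsWithin_of_mem_nhds (hY.isOpen_compl.mem_nhds hzY)] with w h h' using absurd h h'
  let φ : D.ker →ₗ[ℝ] locallyConstantOn (X ∪ Y) :=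
    { toFun := fun p ↦ ⟨X.piecewise p.1.1.1 p.1.2.1, hmem p.2⟩
      map_add' := fun p q ↦ Subtype.ext <| funext fun z ↦ by
        by_cases hz : z ∈ X <;> simp [hz]
      map_smul' := fun r p ↦ Subtype.ext <| funext fun z ↦ by
        by_cases hz : z ∈ X <;> simp [hz] }
  have hφ : Function.Injective φ := (injective_iff_map_eq_zero _).2 fun ⟨p, hp⟩ h ↦ by
    have hz (z : α) : X.piecewise p.1.1 p.2.1 z = 0 := congrFun (congrArg Subtype.val h) z
    refine Subtype.ext (Prod.ext (Subtype.ext <| funext fun z ↦ ?_)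
      (Subtype.ext <| funext fun z ↦ ?_))
    · by_cases hzX : z ∈ X
      · exact (piecewise_eq_of_mem _ _ _ hzX).symm.trans (hz z)
      · exact p.1.2.1 z hzX
    · by_cases hzY : z ∈ Y
      · exact (hright hp hzY).symm.trans (hz z)
      · exact p.2.2.1 z hzY
  rw [← rank_prod', ← LinearMap.rank_range_add_rank_ker D, add_comm]
  refine add_le_add (LinearMap.rank_le_of_injective φ hφ) ?_
  simpa using Submodule.rank_le D.range

theorem Real.rel_of_forall_local {Q : ℝ → ℝ → Prop}
    (hadd : ∀ a b c, a ≤ b → b ≤ c → Q a b → Q b c → Q a c)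
    (hloc : ∀ x, ∃ ε > 0, ∀ a b, x - ε < a → a ≤ x → x ≤ b → b < x + ε → Q a b)
    {a b : ℝ} (hab : a ≤ b) : Q a b := by
  set G := {x | x ∈ Icc a b ∧ Q a x}
  have hbdd : BddAbove G := ⟨b, fun x hx ↦ hx.1.2⟩
  have haG : a ∈ G := by
    obtain ⟨ε, hε, h⟩ := hloc a
    exact ⟨left_mem_Icc.2 hab, h a a (by linarith) le_rfl le_rfl (by linarith)⟩
  obtain ⟨ε, hε, h⟩ := hloc (sSup G)
  obtain ⟨x, hx, hlt⟩ := exists_lt_of_lt_csSup ⟨a, haG⟩ (sub_lt_self (sSup G) hε)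
  have hxs : x ≤ sSup G := le_csSup hbdd hx
  have hsb : sSup G ≤ b := csSup_le ⟨a, haG⟩ fun x hx ↦ hx.1.2
  have hmem {y : ℝ} (hy : sSup G ≤ y) (hyε : y < sSup G + ε) : Q a y :=
    hadd a x y hx.1.1 (hxs.trans hy) hx.2 (h x y hlt hxs hy hyε)
  rcases hsb.eq_or_lt with heq | hsb
  · exact hmem hsb (by linarith)
  have hy : min b (sSup G + ε / 2) ∈ G :=
    ⟨⟨le_min hab ((hx.1.1.trans hxs).trans (by linarith)), min_le_left _ _⟩,
      hmem (le_min hsb.le (by linarith)) ((min_le_right _ _).trans_lt (by linarith))⟩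
  exact absurd (le_csSup hbdd hy) (not_le.2 (lt_min hsb (by linarith)))

open Classical in
theorem Polynomial.card_roots_sub_C_add_countP {T : ℂ[X]} (hT : T.natDegree ≠ 0) (x : ℂ) :
    (T - C x).roots.toFinset.card + T.derivative.roots.countP (fun z ↦ T.eval z = x) =
      T.natDegree := by
  have hderiv : (T - C x).derivative = T.derivative := by simp
  have hne : T - C x ≠ 0 := fun h ↦ hT (by rw [sub_eq_zero.1 h, natDegree_C])
  have hcount : T.derivative.roots.countP (fun z ↦ T.eval z = x) =
      ∑ z ∈ (T - C x).roots.toFinset, ((T - C x).roots.count z - 1) := by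
    rw [Multiset.countP_eq_card_filter, ← Multiset.sum_count_eq_card (s := (T - C x).roots.toFinset)]
    · refine Finset.sum_congr rfl fun z hz ↦ ?_
      have hroot : (T - C x).IsRoot z := isRoot_of_mem_roots (Multiset.mem_toFinset.1 hz)
      have hzx : T.eval z = x := by simpa [sub_eq_zero] using hroot
      rw [Multiset.count_filter_of_pos (p := fun z ↦ T.eval z = x) hzx, count_roots, count_roots, ← hderiv,
        derivative_rootMultiplicity_of_root hroot]
    · intro z hz
      simp [hne, (Multiset.mem_filter.1 hz).2]
  calc _ = ∑ z ∈ (T - C x).roots.toFinset, (T - C x).roots.count z := by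
        rw [hcount, Finset.card_eq_sum_ones, ← Finset.sum_add_distrib]
        refine Finset.sum_congr rfl fun z hz ↦ ?_
        have := Multiset.count_pos.2 (Multiset.mem_toFinset.1 hz)
        omega
    _ = T.natDegree := by
        rw [Multiset.toFinset_sum_count_eq, IsAlgClosed.card_roots_eq_natDegree, natDegree_sub_C]

open Classical in
theorem Polynomial.natDegree_le_rank_locallyConstantOn_add {T : ℂ[X]} (hT : T.natDegree ≠ 0)
    {a b : ℝ} (hab : a ≤ b) :
    (T.natDegree : Cardinal) ≤
      Module.rank ℝ (locallyConstantOn (T.eval ⁻¹' (Complex.ofReal '' Icc a b))) +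
        (T.derivative.roots.countP fun z ↦ T.eval z ∈ Complex.ofReal '' Icc a b : ℕ) := by
  have hne (x : ℂ) : T - C x ≠ 0 := fun h ↦ hT (by rw [sub_eq_zero.1 h, natDegree_C])
  have hfib (x : ℂ) : T.eval ⁻¹' {x} = (T - C x).roots.toFinset := by
    ext z; simp [hne, sub_eq_zero]
  have hclosed (a b : ℝ) : IsClosed (T.eval ⁻¹' (Complex.ofReal '' Icc a b)) :=
    ((isCompact_Icc.image Complex.continuous_ofReal).isClosed).preimage T.continuous
  refine Real.rel_of_forall_local (Q := fun a b ↦ (T.natDegree : Cardinal) ≤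
    Module.rank ℝ (locallyConstantOn (T.eval ⁻¹' (Complex.ofReal '' Icc a b))) +
      (T.derivative.roots.countP fun z ↦ T.eval z ∈ Complex.ofReal '' Icc a b : ℕ)) ?_ ?_ hab
  · intro a b c hab hbc h₁ h₂
    have hor (w : ℂ) : w ∈ Complex.ofReal '' Icc a b ∨ w ∈ Complex.ofReal '' Icc b c ↔
        w ∈ Complex.ofReal '' Icc a c := by
      rw [← mem_union, ← image_union, Icc_union_Icc_eq_Icc hab hbc]
    have hand (w : ℂ) : w ∈ Complex.ofReal '' Icc a b ∧ w ∈ Complex.ofReal '' Icc b c ↔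
        w = (b : ℂ) := by
      rw [← mem_inter_iff, ← image_inter Complex.ofReal_injective, Icc_inter_Icc,
        sup_eq_right.2 hab, inf_eq_left.2 hbc, Icc_self, image_singleton, mem_singleton_iff]
    have hrank := rank_locallyConstantOn_add_le (hclosed a b) (hclosed b c)
      (F := (T - C (b : ℂ)).roots.toFinset) (by rw [← hfib]; ext z; exact hand (T.eval z))
    have hunion : T.eval ⁻¹' (Complex.ofReal '' Icc a b) ∪ T.eval ⁻¹' (Complex.ofReal '' Icc b c) =
        T.eval ⁻¹' (Complex.ofReal '' Icc a c) := by ext z; exact hor (T.eval z)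
    rw [hunion] at hrank
    have hcount : T.derivative.roots.countP (fun z ↦ T.eval z ∈ Complex.ofReal '' Icc a b) +
        T.derivative.roots.countP (fun z ↦ T.eval z ∈ Complex.ofReal '' Icc b c) =
        T.derivative.roots.countP (fun z ↦ T.eval z ∈ Complex.ofReal '' Icc a c) +
        T.derivative.roots.countP (fun z ↦ T.eval z = b) := by
      simp only [Multiset.countP_eq_card_filter, ← Multiset.card_add, ← hor, ← hand]
      rw [Multiset.filter_add_filter]
    rw [← Cardinal.add_nat_le_add_nat_iff T.natDegree]
    refine (add_le_add h₁ h₂).trans ?_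
    rw [add_add_add_comm, ← Nat.cast_add, hcount]
    refine (add_le_add_left hrank _).trans (le_of_eq ?_)
    rw [← card_roots_sub_C_add_countP hT (b : ℂ)]
    push_cast
    ring
  · intro x
    obtain ⟨U, hU, hd⟩ := (T - C (x : ℂ)).roots.toFinset.finite_toSet.t2_separation
    set F := (T - C (x : ℂ)).roots.toFinset
    have hO : IsOpen (⋃ z ∈ F, U z) := isOpen_biUnion fun z _ ↦ (hU z).2
    have himg : IsClosed (T.eval '' (⋃ z ∈ F, U z)ᶜ) := T.isClosedMap_eval _ hO.isClosed_compl
    have hx : (x : ℂ) ∈ (T.eval '' (⋃ z ∈ F, U z)ᶜ)ᶜ := by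
      rintro ⟨z, hz, hzx⟩
      have hzF : z ∈ F := by rw [← Finset.mem_coe, ← hfib]; exact hzx
      exact hz (mem_biUnion hzF (hU z).1)
    obtain ⟨ε, hε, hball⟩ := Metric.isOpen_iff.1 himg.isOpen_compl _ hx
    refine ⟨ε, hε, fun a b ha hax hxb hb ↦ ?_⟩
    have hxmem : (x : ℂ) ∈ Complex.ofReal '' Icc a b := mem_image_of_mem _ ⟨hax, hxb⟩
    have hFne : F.Nonempty := by
      rw [← Finset.coe_nonempty, ← hfib]
      exact (T.isOpenQuotientMap_eval hT).surjective x
    have hcover : T.eval ⁻¹' (Complex.ofReal '' Icc a b) ⊆ ⋃ z ∈ F, U z := by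
      rintro z ⟨y, hy, hyz⟩
      by_contra hz
      refine hball (?_ : T.eval z ∈ _) (mem_image_of_mem _ hz)
      rw [← show (y : ℂ) = T.eval z from hyz, mem_ball, Complex.dist_eq, ← Complex.ofReal_sub, Complex.norm_real,
        Real.norm_eq_abs, abs_lt]
      constructor <;> linarith [hy.1, hy.2]
    have hrank := card_le_rank_locallyConstantOn hFne
      (hfib x ▸ preimage_mono (singleton_subset_iff.2 hxmem)) hU hd hcover
    rw [← card_roots_sub_C_add_countP hT (x : ℂ), Nat.cast_add]
    refine add_le_add hrank (Nat.cast_le.2 ?_)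
    simp only [Multiset.countP_eq_card_filter]
    exact Multiset.card_le_card
      (Multiset.monotone_filter_right _ fun z hz ↦ hz ▸ hxmem)

theorem stmt_4 (n : ℕ) (hn : 1 ≤ n) (T : Polynomial ℂ) (hdeg : T.natDegree = n) :
    IsConnected {z : ℂ | ∃ x : ℝ, x ∈ Set.Icc (-1 : ℝ) 1 ∧ Polynomial.eval z T = (x : ℂ)} ↔
      ∀ z₀ : ℂ, (Polynomial.derivative T).IsRoot z₀ →
        z₀ ∈ {z : ℂ | ∃ x : ℝ, x ∈ Set.Icc (-1 : ℝ) 1 ∧ Polynomial.eval z T = (x : ℂ)} := by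
  classical
  have hT : T.natDegree ≠ 0 := by omega
  have hS : {z : ℂ | ∃ x : ℝ, x ∈ Set.Icc (-1 : ℝ) 1 ∧ Polynomial.eval z T = (x : ℂ)} =
      T.eval ⁻¹' (Complex.ofReal '' Icc (-1) 1) := by
    ext z
    simp only [mem_ofPred_eq, mem_preimage, mem_image, eq_comm]
  rw [hS]
  have hne : (Complex.ofReal '' Icc (-1) 1).Nonempty := (nonempty_Icc.2 (by norm_num)).image _
  constructor
  · intro h z hz
    have hle := (natDegree_le_rank_locallyConstantOn_add hT (by norm_num : (-1 : ℝ) ≤ 1)).trans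
      (add_le_add_left h.isPreconnected.rank_locallyConstantOn_le_one _)
    rw [← Nat.cast_one, ← Nat.cast_add, Nat.cast_le] at hle
    have hcard : T.derivative.roots.card = T.natDegree - 1 := by
      rw [IsAlgClosed.card_roots_eq_natDegree, natDegree_derivative]
    have hall := Multiset.countP_eq_card.1 (le_antisymm (Multiset.countP_le_card _ _)
      (by rw [hcard]; exact Nat.sub_le_iff_le_add'.2 hle))
    have hderiv : T.derivative ≠ 0 := fun h0 ↦ hT (derivative_eq_zero.1 h0)
    exact hall z ((mem_roots hderiv).2 hz)
  · intro h
    exact ⟨hne.preimage (T.isOpenQuotientMap_eval hT).surjective,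
      isPreconnected_preimage_of_convex hT (isCompact_Icc.image Complex.continuous_ofReal) hne
        ((convex_Icc (-1 : ℝ) 1).linear_image Complex.ofRealCLM.toLinearMap) h⟩
end

section
/- Let n ≥ 1 and let z₁⁺, …, z_n⁺, z₁⁻, …, z_n⁻ ∈ ℂ satisfy z_i⁺ ≠ z_j⁻ for all i, j ∈ {1, …, n}, and suppose that ∑_{j=1}^{n}(z_j⁺)^k − ∑_{j=1}^{n}(z_j⁻)^k = 0 for every k with 1 ≤ k ≤ n − 1. Then with τ := −2·∏_{j=1}^{n}(z₁⁻ − z_j⁺)^{−1}, the polynomial T := 1 + τ·∏_{j=1}^{n}(X − z_j⁺) ∈ ℂ[X] has degree n with leading coefficient τ and satisfies T + 1 = τ·∏_{j=1}^{n}(X − z_j⁻). -/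
open Polynomial

/-- In characteristic zero, two families with equal power sums of degrees `1, …, m` have equal
elementary symmetric functions of degrees at most `m`. -/
theorem aeval_esymm_eq_of_sum_pow_eq {σ K : Type*} [Fintype σ] [Field K] [CharZero K]
    {x y : σ → K} {m : ℕ} (h : ∀ k, 1 ≤ k → k ≤ m → ∑ j, x j ^ k = ∑ j, y j ^ k) (k : ℕ)
    (hk : k ≤ m) :
    MvPolynomial.aeval x (MvPolynomial.esymm σ K k) =
      MvPolynomial.aeval y (MvPolynomial.esymm σ K k) := by
  induction k using Nat.strong_induction_on with
  | _ k ih =>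
    rcases Nat.eq_zero_or_pos k with rfl | hpos
    · simp
    have newton (z : σ → K) :=
      congrArg (MvPolynomial.aeval z) (MvPolynomial.mul_esymm_eq_sum σ K k)
    simp only [map_mul, map_natCast, map_pow, map_neg, map_one, map_sum, MvPolynomial.psum,
      MvPolynomial.aeval_X] at newton
    refine mul_left_cancel₀ (Nat.cast_ne_zero.mpr hpos.ne' : (k : K) ≠ 0) ?_
    rw [newton x, newton y]
    congr 1
    refine Finset.sum_congr rfl fun a ha => ?_
    rw [Finset.mem_filter, Finset.HasAntidiagonal.mem_antidiagonal] at ha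
    rw [ih a.1 ha.2 (by lia), h a.2 (by lia) (by lia)]

/-- Two monic split polynomials of degree `n` whose roots have equal power sums of degrees
`1, …, n - 1` differ by a constant. -/
theorem prod_X_sub_C_sub_prod_X_sub_C_eq_C {K : Type*} [Field K] [CharZero K] {n : ℕ}
    {x y : Fin n → K} (h : ∀ k, 1 ≤ k → k ≤ n - 1 → ∑ j, x j ^ k = ∑ j, y j ^ k) :
    ∃ c : K, ∏ j, (X - C (x j)) - ∏ j, (X - C (y j)) = C c := by
  have coeff_eq (z : Fin n → K) {i : ℕ} (hi : i ≤ n) :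
      (∏ j, (X - C (z j))).coeff i =
        (-1) ^ (n - i) * MvPolynomial.aeval z (MvPolynomial.esymm (Fin n) K (n - i)) := by
    have := Multiset.prod_X_sub_C_coeff (Finset.univ.val.map z) (k := i) (by simpa using hi)
    rw [MvPolynomial.aeval_esymm_eq_multiset_esymm]
    simpa [Multiset.map_map, Finset.prod, Function.comp_def] using this
  have natDegree_eq (z : Fin n → K) : (∏ j, (X - C (z j))).natDegree = n := by
    simp [natDegree_finsetProd_X_sub_C_eq_card]
  refine ⟨_, eq_C_of_natDegree_eq_zero ?_⟩
  refine Nat.eq_zero_of_le_zero (natDegree_le_iff_coeff_eq_zero.mpr fun i hi => ?_)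
  rw [coeff_sub, sub_eq_zero]
  rcases le_or_gt i n with hin | hin
  · rw [coeff_eq x hin, coeff_eq y hin, aeval_esymm_eq_of_sum_pow_eq h _ (by lia)]
  · rw [coeff_eq_zero_of_natDegree_lt (by rwa [natDegree_eq]),
      coeff_eq_zero_of_natDegree_lt (by rwa [natDegree_eq])]

theorem stmt_7 (n : ℕ) (hn : 1 ≤ n) (zp zm : Fin n → ℂ)
    (hne : ∀ i j : Fin n, zp i ≠ zm j)
    (hsum : ∀ k : ℕ, 1 ≤ k → k ≤ n - 1 →
      (∑ j : Fin n, zp j ^ k) - (∑ j : Fin n, zm j ^ k) = 0) :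
    ∀ τ : ℂ, τ = -2 * ∏ j : Fin n, (zm ⟨0, hn⟩ - zp j)⁻¹ →
      ∀ T : Polynomial ℂ,
        T = 1 + Polynomial.C τ * ∏ j : Fin n, (Polynomial.X - Polynomial.C (zp j)) →
          T.natDegree = n ∧ T.leadingCoeff = τ ∧
            T + 1 = Polynomial.C τ * ∏ j : Fin n, (Polynomial.X - Polynomial.C (zm j)) := by
  intro τ hτ T hT
  have hprod : ∏ j, (zm ⟨0, hn⟩ - zp j) ≠ 0 :=
    Finset.prod_ne_zero_iff.mpr fun j _ => sub_ne_zero.mpr (hne j _).symm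
  rw [Finset.prod_inv_distrib] at hτ
  have hτ0 : τ ≠ 0 := by
    rw [hτ]
    exact mul_ne_zero (by norm_num) (inv_ne_zero hprod)
  have hmonic : (∏ j, (X - C (zp j))).Monic := monic_prod_X_sub_C zp Finset.univ
  have hdeg : (C τ * ∏ j, (X - C (zp j))).natDegree = n := by
    rw [natDegree_C_mul hτ0]
    simp [natDegree_finsetProd_X_sub_C_eq_card]
  have hlt : (1 : ℂ[X]).degree < (C τ * ∏ j, (X - C (zp j))).degree := by
    apply degree_lt_degree
    rw [hdeg, natDegree_one]
    exact hn
  refine ⟨?_, ?_, ?_⟩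
  · rw [hT, natDegree_add_eq_right_of_degree_lt hlt, hdeg]
  · rw [hT, leadingCoeff_add_of_degree_lt hlt, leadingCoeff_mul, leadingCoeff_C,
      hmonic.leadingCoeff, mul_one]
  · obtain ⟨c, hc⟩ := prod_X_sub_C_sub_prod_X_sub_C_eq_C
      fun k h1 h2 => sub_eq_zero.mp (hsum k h1 h2)
    have heval := congrArg (eval (zm ⟨0, hn⟩)) hc
    have hzero : ∏ j, (zm ⟨0, hn⟩ - zm j) = 0 :=
      Finset.prod_eq_zero (Finset.mem_univ ⟨0, hn⟩) (sub_self _)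
    simp only [eval_sub, eval_prod, eval_X, eval_C, hzero, sub_zero] at heval
    have hτc : τ * c = -2 := by
      rw [hτ, ← heval, mul_assoc, inv_mul_cancel₀ hprod, mul_one]
    have hC : C τ * C c = (-2 : ℂ[X]) := by
      rw [← C_mul, hτc, C_neg, C_ofNat]
    rw [hT]
    linear_combination C τ * hc + hC
end

section
/- Let n ≥ 1 and let T ∈ ℂ[X] have degree n. Then the complement ℂ \ {z ∈ ℂ : T(z) ∈ [−1, 1]} of the inverse image of [−1,1] under T is a connected subset of ℂ. -/
open Polynomial

/-- The exterior of a closed disc centred at the origin is connected. -/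
theorem Complex.isPreconnected_setOf_lt_norm {R : ℝ} (hR : 0 < R) :
    IsPreconnected {z : ℂ | R < ‖z‖} := by
  have h : {z : ℂ | R < ‖z‖} = Complex.exp '' {w : ℂ | Real.log R < w.re} := by
    ext z
    constructor
    · intro hz
      have hz' : R < ‖z‖ := hz
      have hz0 : z ≠ 0 := norm_pos_iff.1 (hR.trans hz')
      refine ⟨Complex.log z, ?_, Complex.exp_log hz0⟩
      simpa [Complex.log_re] using Real.log_lt_log hR hz'
    · rintro ⟨w, hw, rfl⟩
      simpa [Complex.norm_exp] using (Real.log_lt_iff_lt_exp hR).1 hw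
  rw [h]
  exact (convex_halfSpace_re_gt _).isPreconnected.image _ Complex.continuous_exp.continuousOn

/-- A polynomial which is real on the frontier of a bounded set is real on the set. -/
theorem Polynomial.im_eval_eq_zero_of_frontier (T : ℂ[X]) {U : Set ℂ}
    (hU : Bornology.IsBounded U) (hT : ∀ z ∈ frontier U, (T.eval z).im = 0) {z : ℂ}
    (hz : z ∈ U) : (T.eval z).im = 0 := by
  have key (c : ℂ) (hc : c.re = 0) : (c * T.eval z).re ≤ 0 := by
    have hd : Differentiable ℂ fun w => Complex.exp (c * T.eval w) :=
      (T.differentiable.const_mul c).cexp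
    have h := Complex.norm_le_of_forall_mem_frontier_norm_le hU hd.diffContOnCl
      (C := 1) (fun w hw => by simp [Complex.norm_exp, hc, hT w hw]) (subset_closure hz)
    simpa [Complex.norm_exp] using h
  have h₁ := key Complex.I (by simp)
  have h₂ := key (-Complex.I) (by simp)
  simp at h₁ h₂
  linarith

/-- A nonconstant polynomial cannot be real on a nonempty open set. -/
theorem Polynomial.exists_im_eval_ne_zero {T : ℂ[X]} (hT : T.natDegree ≠ 0) {U : Set ℂ}
    (hU : IsOpen U) (hne : U.Nonempty) : ∃ z ∈ U, (T.eval z).im ≠ 0 := by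
  by_contra! h
  obtain ⟨z, hz⟩ := hne
  have himage := (T.isOpenQuotientMap_eval hT).isOpenMap U hU
  have him := Complex.isOpenMap_im _ himage
  have heq : Complex.im '' (T.eval '' U) = {0} := by
    ext y
    constructor
    · rintro ⟨_, ⟨w, hw, rfl⟩, rfl⟩
      exact h w hw
    · rintro rfl
      exact ⟨_, ⟨z, hz, rfl⟩, h z hz⟩
  rw [heq] at him
  exact not_isOpen_singleton (0 : ℝ) him

/-- In a locally connected space, the frontier of a component of an open set misses that set. -/
theorem IsOpen.frontier_connectedComponentIn_subset_compl {X : Type*} [TopologicalSpace X]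
    [LocallyConnectedSpace X] {S : Set X} (hS : IsOpen S) (x : X) :
    frontier (connectedComponentIn S x) ⊆ Sᶜ := by
  intro w hw hwS
  rw [(hS.connectedComponentIn).frontier_eq] at hw
  obtain ⟨y, hyw, hyx⟩ := mem_closure_iff.1 hw.1 _ hS.connectedComponentIn
    (mem_connectedComponentIn hwS)
  apply hw.2
  rw [connectedComponentIn_eq hyx, ← connectedComponentIn_eq hyw]
  exact mem_connectedComponentIn hwS

theorem stmt_8 (n : ℕ) (hn : 1 ≤ n) (T : Polynomial ℂ) (hdeg : T.natDegree = n) :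
    IsConnected
      {z : ℂ | ∃ x : ℝ, x ∈ Set.Icc (-1 : ℝ) 1 ∧ Polynomial.eval z T = (x : ℂ)}ᶜ := by
  set K : Set ℂ := {z : ℂ | ∃ x : ℝ, x ∈ Set.Icc (-1 : ℝ) 1 ∧ T.eval z = (x : ℂ)} with hK
  have hdeg₀ : T.natDegree ≠ 0 := by omega
  have hKc : IsCompact K := by
    have hpre : K = T.eval ⁻¹' (Complex.ofReal '' Set.Icc (-1 : ℝ) 1) := by
      ext z
      simp [hK, eq_comm]
    rw [hpre]
    exact (T.isProperMap_eval (natDegree_pos_iff_degree_pos.1 (by omega))).isCompact_preimage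
      (isCompact_Icc.image Complex.continuous_ofReal)
  have hS : IsOpen Kᶜ := hKc.isClosed.isOpen_compl
  obtain ⟨R, hR, hKR⟩ := hKc.isBounded.exists_pos_norm_le
  have hext : {z : ℂ | R < ‖z‖} ⊆ Kᶜ := fun z hz hzK => (hKR z hzK).not_gt hz
  have hx₀ : ((R + 1 : ℝ) : ℂ) ∈ {z : ℂ | R < ‖z‖} := by
    rw [Set.mem_ofPred_eq, Complex.norm_real, Real.norm_of_nonneg (by linarith)]
    linarith
  refine ⟨⟨_, hext hx₀⟩, isPreconnected_of_forall ((R + 1 : ℝ) : ℂ) fun y hy =>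
    ⟨connectedComponentIn Kᶜ y, connectedComponentIn_subset _ _, ?_,
      mem_connectedComponentIn hy, isPreconnected_connectedComponentIn⟩⟩
  obtain ⟨z, hzy, hz⟩ : ∃ z ∈ connectedComponentIn Kᶜ y, R < ‖z‖ := by
    by_contra! hb
    obtain ⟨z, hz, him⟩ := exists_im_eval_ne_zero hdeg₀ hS.connectedComponentIn
      ⟨y, mem_connectedComponentIn hy⟩
    refine him (T.im_eval_eq_zero_of_frontier (isBounded_iff_forall_norm_le.2 ⟨R, hb⟩)
      (fun w hw => ?_) hz)
    obtain ⟨x, -, hx⟩ := not_not.1 (hS.frontier_connectedComponentIn_subset_compl y hw)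
    rw [hx, Complex.ofReal_im]
  rw [connectedComponentIn_eq hzy]
  exact (Complex.isPreconnected_setOf_lt_norm hR).subset_connectedComponentIn hz hext hx₀
end

section
/- Let n ≥ 1, ν ≥ 2 with n ≥ 2ν − 3. Let c₁, …, c_ν, d₁, …, d_{ν−2}, z₁, …, z_{n−2ν+3} ∈ ℂ be pairwise distinct points and let α₁, …, α_ν, γ₁, …, γ_{ν−2}, β₁, …, β_{n−2ν+3} ∈ {−1, 1} be signs satisfying ∑_{j=1}^{ν} α_j + 3·∑_{j=1}^{ν−2} γ_j + 2·∑_{j=1}^{n−2ν+3} β_j = 0 and, for every k with 1 ≤ k ≤ n − 1, ∑_{j=1}^{ν} α_j c_j^k + 3·∑_{j=1}^{ν−2} γ_j d_j^k + 2·∑_{j=1}^{n−2ν+3} β_j z_j^k = 0. Then there exist τ ∈ ℂ \ {0} and a polynomial T ∈ ℂ[X] of degree n with leading coefficient τ such that T − 1 = τ·∏_{j : α_j = 1}(X − c_j)·∏_{j : γ_j = 1}(X − d_j)³·∏_{j : β_j = 1}(X − z_j)² and T + 1 = τ·∏_{j : α_j = −1}(X − c_j)·∏_{j : γ_j = −1}(X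 − d_j)³·∏_{j : β_j = −1}(X − z_j)², so that in particular T² − 1 = τ²·∏_{j=1}^{ν}(X − c_j)·∏_{j=1}^{ν−2}(X − d_j)³·∏_{j=1}^{n−2ν+3}(X − z_j)². -/
open Polynomial

theorem Multiset.mul_esymm_eq_sum {R : Type*} [CommRing R] (s : Multiset R) (k : ℕ) :
    k * s.esymm k = (-1) ^ (k + 1) * ∑ a ∈ Finset.HasAntidiagonal.antidiagonal k with a.1 < k,
      (-1) ^ a.1 * s.esymm a.1 * (s.map (· ^ a.2)).sum := by
  classical
  have hs : (Finset.univ : Finset s).val.map (fun x : s => (x : R)) = s := s.map_univ_coe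
  have hpsum (m : ℕ) : ∑ x : s, (x : R) ^ m = (s.map (· ^ m)).sum := by
    conv_rhs => rw [← hs, Multiset.map_map]
    rfl
  have hesymm (m : ℕ) :
      MvPolynomial.eval (fun x : s => (x : R)) (MvPolynomial.esymm s R m) = s.esymm m := by
    rw [← MvPolynomial.coe_aeval_eq_eval, RingHom.coe_coe,
      MvPolynomial.aeval_esymm_eq_multiset_esymm, hs]
  simpa [hesymm, MvPolynomial.psum, hpsum] using
    congrArg (MvPolynomial.eval fun x : s => (x : R)) (MvPolynomial.mul_esymm_eq_sum s R k)

theorem Multiset.esymm_eq_of_sum_pow_eq {R : Type*} [CommRing R] [IsDomain R] [CharZero R]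
    {s t : Multiset R} {n : ℕ}
    (h : ∀ k, 1 ≤ k → k < n → (s.map (· ^ k)).sum = (t.map (· ^ k)).sum) {k : ℕ} (hk : k < n) :
    s.esymm k = t.esymm k := by
  induction k using Nat.strong_induction_on with
  | _ k ih =>
    rcases Nat.eq_zero_or_pos k with rfl | hpos
    · simp [Multiset.esymm]
    · refine mul_left_cancel₀ (Nat.cast_ne_zero (R := R).2 hpos.ne') ?_
      rw [s.mul_esymm_eq_sum, t.mul_esymm_eq_sum]
      congr 1
      refine Finset.sum_congr rfl fun a ha => ?_
      obtain ⟨hak, hlt⟩ := Finset.mem_filter.1 ha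
      rw [Finset.HasAntidiagonal.mem_antidiagonal] at hak
      rw [ih a.1 hlt (hlt.trans hk), h a.2 (by lia) (by lia)]

theorem Polynomial.exists_prod_X_sub_C_sub_eq_C_of_sum_pow_eq {R : Type*} [CommRing R]
    [IsDomain R] [CharZero R] {s t : Multiset R} (hst : s.card = t.card)
    (h : ∀ k, 1 ≤ k → k < s.card → (s.map (· ^ k)).sum = (t.map (· ^ k)).sum) :
    ∃ r : R, (s.map fun a => X - C a).prod - (t.map fun a => X - C a).prod = C r := by
  refine ⟨_, eq_C_of_natDegree_eq_zero (Nat.le_zero.1 (natDegree_le_iff_coeff_eq_zero.2 ?_))⟩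
  intro k hk
  rw [coeff_sub, sub_eq_zero]
  rcases le_or_gt k s.card with hks | hks
  · rw [Multiset.prod_X_sub_C_coeff s hks, Multiset.prod_X_sub_C_coeff t (hst ▸ hks), ← hst,
      Multiset.esymm_eq_of_sum_pow_eq h (by lia)]
  · rw [coeff_eq_zero_of_natDegree_lt, coeff_eq_zero_of_natDegree_lt] <;>
      simpa only [natDegree_multiset_prod_X_sub_C_eq_card, ← hst] using hks

theorem Finset.sum_filter_eq_one_sub_sum_filter_eq_neg_one {ι R : Type*} [Fintype ι] [CommRing R]
    {e : ι → ℤ} (he : ∀ j, e j = 1 ∨ e j = -1) (f : ι → R) :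
    ∑ j with e j = 1, f j - ∑ j with e j = -1, f j = ∑ j, (e j : R) * f j := by
  rw [Finset.sum_filter, Finset.sum_filter, ← Finset.sum_sub_distrib]
  refine Finset.sum_congr rfl fun j _ => ?_
  rcases he j with h | h <;> simp [h]

theorem Finset.prod_filter_eq_one_mul_prod_filter_eq_neg_one {ι M : Type*} [Fintype ι]
    [CommMonoid M] {e : ι → ℤ} (he : ∀ j, e j = 1 ∨ e j = -1) (f : ι → M) :
    (∏ j with e j = 1, f j) * ∏ j with e j = -1, f j = ∏ j, f j := by
  rw [Finset.prod_filter, Finset.prod_filter, ← Finset.prod_mul_distrib]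
  refine Finset.prod_congr rfl fun j _ => ?_
  rcases he j with h | h <;> simp [h]

theorem Finset.card_filter_eq_one_add_card_filter_eq_neg_one {ι : Type*} [Fintype ι]
    {e : ι → ℤ} (he : ∀ j, e j = 1 ∨ e j = -1) :
    (Finset.univ.filter fun j => e j = 1).card + (Finset.univ.filter fun j => e j = -1).card = Fintype.card ι := by
  rw [Finset.card_filter, Finset.card_filter, ← Finset.sum_add_distrib, Fintype.card_eq_sum_ones]
  refine Finset.sum_congr rfl fun j _ => ?_
  rcases he j with h | h <;> simp [h]

theorem Finset.card_filter_eq_one_sub_card_filter_eq_neg_one {ι : Type*} [Fintype ι]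
    {e : ι → ℤ} (he : ∀ j, e j = 1 ∨ e j = -1) :
    ((Finset.univ.filter fun j => e j = 1).card : ℤ) - (Finset.univ.filter fun j => e j = -1).card = ∑ j, e j := by
  simpa using Finset.sum_filter_eq_one_sub_sum_filter_eq_neg_one he fun _ => (1 : ℤ)

/-- The roots `c j`, `d j`, `w j` with sign `ε`, with multiplicities `1`, `3`, `2`. -/
def signedRoots {ι κ l R : Type*} [Fintype ι] [Fintype κ] [Fintype l] (c : ι → R) (d : κ → R)
    (w : l → R) (α : ι → ℤ) (γ : κ → ℤ) (β : l → ℤ) (ε : ℤ) : Multiset R :=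
  (Finset.univ.filter fun j => α j = ε).val.map c +
    3 • (Finset.univ.filter fun j => γ j = ε).val.map d +
    2 • (Finset.univ.filter fun j => β j = ε).val.map w

section signedRoots

variable {ι κ l R : Type*} [Fintype ι] [Fintype κ] [Fintype l] (c : ι → R) (d : κ → R)
  (w : l → R) (α : ι → ℤ) (γ : κ → ℤ) (β : l → ℤ) (ε : ℤ)

theorem card_signedRoots : (signedRoots c d w α γ β ε).card =
    (Finset.univ.filter fun j => α j = ε).card + 3 * (Finset.univ.filter fun j => γ j = ε).card +
      2 * (Finset.univ.filter fun j => β j = ε).card := by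
  simp [signedRoots]
  rfl

theorem sum_map_signedRoots [CommRing R] (f : R → R) :
    ((signedRoots c d w α γ β ε).map f).sum =
      ∑ j with α j = ε, f (c j) + 3 * ∑ j with γ j = ε, f (d j) +
        2 * ∑ j with β j = ε, f (w j) := by
  simp [signedRoots, Multiset.map_nsmul, Multiset.sum_nsmul]
  rfl

theorem prod_map_signedRoots {S : Type*} [CommRing S] (f : R → S) :
    ((signedRoots c d w α γ β ε).map f).prod =
      (∏ j with α j = ε, f (c j)) * (∏ j with γ j = ε, f (d j) ^ 3) *
        ∏ j with β j = ε, f (w j) ^ 2 := by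
  simp [signedRoots, Multiset.map_nsmul, Multiset.prod_nsmul, Finset.prod_pow]
  rfl

theorem disjoint_signedRoots (h : Function.Injective (Sum.elim c (Sum.elim d w))) {ε ε' : ℤ}
    (hε : ε ≠ ε') :
    Disjoint (signedRoots c d w α γ β ε) (signedRoots c d w α γ β ε') := by
  have key (ε : ℤ) {x : R} (hx : x ∈ signedRoots c d w α γ β ε) :
      ∃ i, Sum.elim c (Sum.elim d w) i = x ∧ Sum.elim α (Sum.elim γ β) i = ε := by
    simp only [signedRoots, Multiset.mem_add, Multiset.mem_nsmul, Multiset.mem_map] at hx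
    rcases hx with (⟨j, hj, rfl⟩ | ⟨-, j, hj, rfl⟩) | ⟨-, j, hj, rfl⟩
    · exact ⟨.inl j, rfl, by simpa using hj⟩
    · exact ⟨.inr (.inl j), rfl, by simpa using hj⟩
    · exact ⟨.inr (.inr j), rfl, by simpa using hj⟩
  refine Multiset.disjoint_left.2 fun {x} hx hx' => ?_
  obtain ⟨i, hi, hiε⟩ := key ε hx
  obtain ⟨i', hi', hiε'⟩ := key ε' hx'
  exact hε (hiε.symm.trans ((congrArg _ (h (hi.trans hi'.symm))).trans hiε'))

end signedRoots

theorem stmt_10 (n ν : ℕ) (hn : 1 ≤ n) (hν : 2 ≤ ν) (hnν : 2 * ν - 3 ≤ n)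
    (c : Fin ν → ℂ) (d : Fin (ν - 2) → ℂ) (w : Fin (n + 3 - 2 * ν) → ℂ)
    (hdist : Function.Injective (Sum.elim c (Sum.elim d w)))
    (α : Fin ν → ℤ) (γ : Fin (ν - 2) → ℤ) (β : Fin (n + 3 - 2 * ν) → ℤ)
    (hα : ∀ j, α j = 1 ∨ α j = -1) (hγ : ∀ j, γ j = 1 ∨ γ j = -1)
    (hβ : ∀ j, β j = 1 ∨ β j = -1)
    (hsign : (∑ j, α j) + 3 * (∑ j, γ j) + 2 * (∑ j, β j) = 0)
    (hpow : ∀ k : ℕ, 1 ≤ k → k ≤ n - 1 →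
      (∑ j, (α j : ℂ) * c j ^ k) + 3 * (∑ j, (γ j : ℂ) * d j ^ k)
        + 2 * (∑ j, (β j : ℂ) * w j ^ k) = 0) :
    ∃ τ : ℂ, τ ≠ 0 ∧ ∃ T : Polynomial ℂ, T.natDegree = n ∧ T.leadingCoeff = τ ∧
      T - 1 = Polynomial.C τ *
          (∏ j ∈ Finset.univ.filter (fun j => α j = 1), (Polynomial.X - Polynomial.C (c j))) *
          (∏ j ∈ Finset.univ.filter (fun j => γ j = 1), (Polynomial.X - Polynomial.C (d j)) ^ 3) *
          (∏ j ∈ Finset.univ.filter (fun j => β j = 1), (Polynomial.X - Polynomial.C (w j)) ^ 2) ∧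
      T + 1 = Polynomial.C τ *
          (∏ j ∈ Finset.univ.filter (fun j => α j = -1), (Polynomial.X - Polynomial.C (c j))) *
          (∏ j ∈ Finset.univ.filter (fun j => γ j = -1), (Polynomial.X - Polynomial.C (d j)) ^ 3) *
          (∏ j ∈ Finset.univ.filter (fun j => β j = -1), (Polynomial.X - Polynomial.C (w j)) ^ 2) ∧
      T ^ 2 - 1 = Polynomial.C (τ ^ 2) *
          (∏ j : Fin ν, (Polynomial.X - Polynomial.C (c j))) *
          (∏ j : Fin (ν - 2), (Polynomial.X - Polynomial.C (d j)) ^ 3) *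
          (∏ j : Fin (n + 3 - 2 * ν), (Polynomial.X - Polynomial.C (w j)) ^ 2) := by
  set s := signedRoots c d w α γ β 1 with hs
  set t := signedRoots c d w α γ β (-1) with ht
  have hcα := Finset.card_filter_eq_one_add_card_filter_eq_neg_one hα
  have hcγ := Finset.card_filter_eq_one_add_card_filter_eq_neg_one hγ
  have hcβ := Finset.card_filter_eq_one_add_card_filter_eq_neg_one hβ
  have hdα := Finset.card_filter_eq_one_sub_card_filter_eq_neg_one hα
  have hdγ := Finset.card_filter_eq_one_sub_card_filter_eq_neg_one hγ
  have hdβ := Finset.card_filter_eq_one_sub_card_filter_eq_neg_one hβ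
  have hcs := card_signedRoots c d w α γ β 1
  have hct := card_signedRoots c d w α γ β (-1)
  rw [← hs] at hcs
  rw [← ht] at hct
  rw [Fintype.card_fin] at hcα hcγ hcβ
  have hsn : s.card = n := by lia
  have htn : t.card = n := by lia
  have hsum (k : ℕ) (hk : 1 ≤ k) (hkn : k < s.card) :
      (s.map (· ^ k)).sum = (t.map (· ^ k)).sum := by
    rw [hs, ht, sum_map_signedRoots, sum_map_signedRoots]
    linear_combination hpow k hk (by lia)
      + Finset.sum_filter_eq_one_sub_sum_filter_eq_neg_one hα (fun j => c j ^ k)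
      + 3 * Finset.sum_filter_eq_one_sub_sum_filter_eq_neg_one hγ (fun j => d j ^ k)
      + 2 * Finset.sum_filter_eq_one_sub_sum_filter_eq_neg_one hβ (fun j => w j ^ k)
  obtain ⟨r, hr⟩ := exists_prod_X_sub_C_sub_eq_C_of_sum_pow_eq (hsn.trans htn.symm) hsum
  have hr0 : r ≠ 0 := by
    rintro rfl
    rw [map_zero, sub_eq_zero] at hr
    have hst : s = t := by
      simpa only [roots_multiset_prod_X_sub_C] using congrArg roots hr
    have hdisj : Disjoint s t := disjoint_signedRoots c d w α γ β hdist (by norm_num)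
    rw [← hst, disjoint_self, Multiset.bot_eq_zero] at hdisj
    simp [hdisj] at hsn
    lia
  have hτ : -2 / r ≠ 0 := div_ne_zero (by norm_num) hr0
  have hτr : C (-2 / r) * C r = (-2 : ℂ[X]) := by
    rw [← C_mul, div_mul_cancel₀ _ hr0, C_neg, C_ofNat]
  have hPs := prod_map_signedRoots c d w α γ β 1 fun a => X - C a
  have hPt := prod_map_signedRoots c d w α γ β (-1) fun a => X - C a
  rw [← hs] at hPs
  rw [← ht] at hPt
  set P := (s.map fun a => X - C a).prod
  set Q := (t.map fun a => X - C a).prod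
  have hPmonic : P.Monic := monic_multisetProd_X_sub_C s
  have hPdeg : P.natDegree = n := (natDegree_multiset_prod_X_sub_C_eq_card s).trans hsn
  have hCP : (C (-2 / r) * P).natDegree = n := by rw [natDegree_C_mul hτ, hPdeg]
  have hone : (1 : ℂ[X]).degree < (C (-2 / r) * P).degree := by
    rw [degree_one]
    exact natDegree_pos_iff_degree_pos.1 (by lia)
  have hminus : C (-2 / r) * P + 1 - 1 = C (-2 / r) * P := by ring
  have hplus : C (-2 / r) * P + 1 + 1 = C (-2 / r) * Q := by
    linear_combination C (-2 / r) * hr + hτr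
  refine ⟨-2 / r, hτ, C (-2 / r) * P + 1, ?_, ?_, ?_, ?_, ?_⟩
  · rw [← C_1, natDegree_add_C, hCP]
  · rw [leadingCoeff_add_of_degree_lt' hone, leadingCoeff_mul, leadingCoeff_C,
      hPmonic.leadingCoeff, mul_one]
  · rw [hminus, hPs]
    ring
  · rw [hplus, hPt]
    ring
  · rw [← Finset.prod_filter_eq_one_mul_prod_filter_eq_neg_one hα,
      ← Finset.prod_filter_eq_one_mul_prod_filter_eq_neg_one hγ,
      ← Finset.prod_filter_eq_one_mul_prod_filter_eq_neg_one hβ, C_pow]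
    calc (C (-2 / r) * P + 1) ^ 2 - 1
        = (C (-2 / r) * P + 1 - 1) * (C (-2 / r) * P + 1 + 1) := by ring
      _ = _ := by
        rw [hminus, hplus, hPs, hPt]
        ring
end

section
/- Let n ≥ 1, ν ≥ 2 with n ≥ 2ν − 3, let c₁, …, c_ν, d₁, …, d_{ν−2}, z₁, …, z_{n−2ν+3} ∈ ℂ be pairwise distinct, let τ ∈ ℂ \ {0}, and let T ∈ ℂ[X] be a polynomial of degree n with leading coefficient τ such that T² − 1 = τ²·∏_{j=1}^{ν}(X − c_j)·∏_{j=1}^{ν−2}(X − d_j)³·∏_{j=1}^{n−2ν+3}(X − z_j)². Then the derivative satisfies T′ = n·τ·∏_{j=1}^{ν−2}(X − d_j)²·∏_{j=1}^{n−2ν+3}(X − z_j), every root of T′ lies in T⁻¹([−1,1]), and consequently the inverse image {z ∈ ℂ : T(z) ∈ [−1, 1]} is connected. -/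
open Polynomial

theorem derivative_eq_of_sq_sub_one_eq {T D W Q : ℂ[X]} {n : ℕ} (hn : T.natDegree = n)
    (hD : D.Monic) (hW : W.Monic) (hdeg : 2 * D.natDegree + W.natDegree + 1 = n)
    (h : T ^ 2 - 1 = Q * D ^ 3 * W ^ 2) :
    derivative T = C ((n : ℂ) * T.leadingCoeff) * D ^ 2 * W := by
  have hcop : IsCoprime (D ^ 2 * W) T := by
    refine ⟨-(Q * D * W), T, ?_⟩
    linear_combination h
  have hdvd : D ^ 2 * W ∣ derivative T := by
    refine hcop.dvd_of_dvd_mul_left ?_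
    have h2 : C 2 * (T * derivative T) = D ^ 2 * W *
        (derivative Q * D * W + 3 * Q * derivative D * W + 2 * Q * D * derivative W) := by
      have := congrArg derivative h
      simp only [derivative_sub, derivative_pow, derivative_mul, derivative_one] at this
      simp only [map_natCast, map_ofNat] at this ⊢
      norm_num at this
      linear_combination this
    have h3 : D ^ 2 * W ∣ C 2 * (T * derivative T) := ⟨_, h2⟩
    exact ((isUnit_C.2 (by norm_num : IsUnit (2 : ℂ))).dvd_mul_left).1 h3
  have hA : (D ^ 2 * W).Monic := (hD.pow 2).mul hW
  have hAdeg : (D ^ 2 * W).natDegree = n - 1 := by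
    rw [(hD.pow 2).natDegree_mul hW, hD.natDegree_pow]; omega
  have hT' : (derivative T).natDegree = n - 1 := by rw [natDegree_derivative, hn]
  have hlead : (derivative T).leadingCoeff = n * T.leadingCoeff := by
    rw [leadingCoeff_derivative, hn, mul_comm]
  have := eq_mul_leadingCoeff_of_monic_of_dvd_of_natDegree_le hA hdvd (by omega)
  rw [this, hlead]
  ring

open Complex in
theorem norm_cosh_sub_one_add (s : ℂ) :
    ‖cosh s - 1‖ + ‖cosh s + 1‖ = 2 * Real.cosh s.re := by
  have h1 : cosh s - 1 = 2 * sinh (s / 2) ^ 2 := by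
    have h := cosh_two_mul (s / 2)
    have h' := cosh_sq_sub_sinh_sq (s / 2)
    rw [show 2 * (s / 2) = s by ring] at h
    linear_combination h + h'
  have h2 : cosh s + 1 = 2 * cosh (s / 2) ^ 2 := by
    have h := cosh_two_mul (s / 2)
    have h' := cosh_sq_sub_sinh_sq (s / 2)
    rw [show 2 * (s / 2) = s by ring] at h
    linear_combination h - h'
  rw [h1, h2, norm_mul, norm_mul, norm_pow, norm_pow,
    ← Complex.normSq_eq_norm_sq, ← Complex.normSq_eq_norm_sq]
  obtain ⟨x, y, hxy⟩ : ∃ x y : ℝ, s / 2 = x + y * I := ⟨_, _, (re_add_im _).symm⟩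
  have hre : s.re = 2 * x := by
    have := congrArg Complex.re hxy
    simp at this; linarith
  rw [hxy, hre, sinh_add, cosh_add, sinh_mul_I, cosh_mul_I, Real.cosh_two_mul]
  simp only [← ofReal_cosh, ← ofReal_sinh, ← ofReal_cos, ← ofReal_sin, normSq_apply]
  simp [- ofReal_cosh, - ofReal_sinh, - ofReal_cos, - ofReal_sin]
  have := Real.sin_sq_add_cos_sq y
  have := Real.cosh_sq x
  ring_nf
  grind

theorem two_lt_norm_cosh_sub_one_add_iff (s : ℂ) :
    2 < ‖Complex.cosh s - 1‖ + ‖Complex.cosh s + 1‖ ↔ s.re ≠ 0 := by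
  rw [norm_cosh_sub_one_add, ← Real.one_lt_cosh]
  constructor <;> intro h <;> linarith

theorem Complex.cosh_surjective : Function.Surjective Complex.cosh := fun u ↦ by
  obtain ⟨x, hx⟩ := Complex.cos_surjective u
  exact ⟨x * I, by rw [Complex.cosh_mul_I, hx]⟩

theorem norm_sub_one_add_norm_add_one_le_two_iff (u : ℂ) :
    ‖u - 1‖ + ‖u + 1‖ ≤ 2 ↔ ∃ x : ℝ, x ∈ Set.Icc (-1 : ℝ) 1 ∧ u = x := by
  constructor
  · intro h
    obtain ⟨s, rfl⟩ := Complex.cosh_surjective u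
    have hs : s.re = 0 := by
      by_contra hs
      exact absurd ((two_lt_norm_cosh_sub_one_add_iff s).2 hs) (not_lt.2 h)
    refine ⟨Real.cos s.im, Real.cos_mem_Icc _, ?_⟩
    rw [← Complex.re_add_im s, hs]
    simp [Complex.cosh_mul_I]
  · rintro ⟨x, ⟨h1, h2⟩, rfl⟩
    have e1 : ‖(x : ℂ) - 1‖ = 1 - x := by
      rw [← Complex.ofReal_one, ← Complex.ofReal_sub, Complex.norm_real, Real.norm_eq_abs,
        abs_of_nonpos] <;> linarith
    have e2 : ‖(x : ℂ) + 1‖ = 1 + x := by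
      rw [← Complex.ofReal_one, ← Complex.ofReal_add, Complex.norm_real, Real.norm_eq_abs,
        abs_of_nonneg] <;> linarith
    linarith

/-- The open right half-plane. -/
abbrev RightHalfPlane : Type := {s : ℂ // 0 < s.re}

namespace RightHalfPlane

theorem isOpen_setOf : IsOpen {s : ℂ | 0 < s.re} :=
  isOpen_lt continuous_const Complex.continuous_re

instance : ContractibleSpace RightHalfPlane :=
  (convex_halfSpace_re_gt 0).contractibleSpace ⟨1, by simp⟩

instance : LocallyPathConnectedSpace RightHalfPlane :=
  isOpen_setOf.locallyPathConnectedSpace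

/-- The restriction of `cosh` to the right half-plane; it parametrizes the complement of
`[-1, 1]`. -/
noncomputable def cosh : C(RightHalfPlane, ℂ) :=
  ⟨fun s ↦ Complex.cosh s, by fun_prop⟩

theorem cosh_apply (s : RightHalfPlane) : cosh s = Complex.cosh s := rfl

theorem two_lt_norm_cosh (s : RightHalfPlane) : 2 < ‖cosh s - 1‖ + ‖cosh s + 1‖ :=
  (two_lt_norm_cosh_sub_one_add_iff s).2 s.2.ne'

theorem exists_cosh_eq {u : ℂ} (hu : 2 < ‖u - 1‖ + ‖u + 1‖) :
    ∃ s : RightHalfPlane, cosh s = u := by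
  obtain ⟨s, rfl⟩ := Complex.cosh_surjective u
  rcases ((two_lt_norm_cosh_sub_one_add_iff s).1 hu).lt_or_gt with h | h
  · exact ⟨⟨-s, by simpa using h⟩, by simp [cosh_apply]⟩
  · exact ⟨⟨s, h⟩, rfl⟩

theorem exists_eq_add_of_cosh_eq {a b : RightHalfPlane} (h : cosh a = cosh b) :
    ∃ k : ℤ, (b : ℂ) = a + k * (2 * Real.pi * Complex.I) := by
  rw [cosh_apply, cosh_apply, ← Complex.cos_mul_I, ← Complex.cos_mul_I,
    Complex.cos_eq_cos_iff] at h
  obtain ⟨k, hk⟩ := h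
  have ha := a.2
  have hb := b.2
  rcases hk with hk | hk
  · refine ⟨-k, ?_⟩
    push_cast
    linear_combination (-Complex.I) * hk - ((a : ℂ) - b) * Complex.I_mul_I
  · have := congrArg Complex.im hk
    simp at this
    linarith

theorem isLocalHomeomorph_cosh : IsLocalHomeomorph cosh := by
  have h : IsLocalHomeomorphOn Complex.cosh {s : ℂ | 0 < s.re} := by
    refine IsLocalHomeomorphOn.mk _ _ fun s hs ↦ ?_
    have hne : Complex.sinh s ≠ 0 := fun h0 ↦ by
      have h1 := Complex.cosh_sq s
      rw [h0] at h1
      have h2 := (two_lt_norm_cosh_sub_one_add_iff s).2 (ne_of_gt hs)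
      rcases sq_eq_one_iff.1 (h1.trans (by simp)) with h3 | h3 <;>
        rw [h3] at h2 <;> norm_num at h2
    have hd := (Complex.hasStrictDerivAt_cosh s).hasStrictFDerivAt_equiv hne
    exact ⟨hd.toOpenPartialHomeomorph, hd.mem_toOpenPartialHomeomorph_source, fun _ _ ↦ by simp⟩
  rw [isLocalHomeomorph_iff_isLocalHomeomorphOn_univ]
  exact h.comp (isLocalHomeomorph_iff_isLocalHomeomorphOn_univ.1
    isOpen_setOf.isOpenEmbedding_subtypeVal.isLocalHomeomorph) fun s _ ↦ s.2

/-- Vertical translation by an integral multiple of the period `2 * π * I` of `cosh`. -/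
noncomputable def shift (k : ℤ) : C(RightHalfPlane, RightHalfPlane) :=
  ⟨fun s ↦ ⟨s + k * (2 * Real.pi * Complex.I), by simpa using s.2⟩, by fun_prop⟩

theorem cosh_shift (k : ℤ) (s : RightHalfPlane) : cosh (shift k s) = cosh s :=
  Complex.cosh_periodic.int_mul k s

end RightHalfPlane

namespace Polynomial

variable {T : ℂ[X]}

/-- `F` is a lift of `cosh` along the polynomial map `T`. -/
def IsCoshLift (T : ℂ[X]) (F : C(RightHalfPlane, ℂ)) : Prop :=
  ∀ s, T.eval (F s) = RightHalfPlane.cosh s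

theorem isCoveringMapOn_eval_of_critical_values
    (hcrit : ∀ z, T.derivative.IsRoot z → ‖T.eval z - 1‖ + ‖T.eval z + 1‖ ≤ 2) :
    IsCoveringMapOn T.eval {u : ℂ | 2 < ‖u - 1‖ + ‖u + 1‖} := by
  refine T.isCoveringMapOn_eval.mono ?_
  rintro u hu ⟨z, hz, rfl⟩
  exact absurd hu (not_lt.2 (hcrit z hz))

theorem existsUnique_isCoshLift
    (hcrit : ∀ z, T.derivative.IsRoot z → ‖T.eval z - 1‖ + ‖T.eval z + 1‖ ≤ 2)
    {s : RightHalfPlane} {z : ℂ} (h : T.eval z = RightHalfPlane.cosh s) :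
    ∃! F : C(RightHalfPlane, ℂ), F s = z ∧ IsCoshLift T F := by
  have := (isCoveringMapOn_eval_of_critical_values hcrit).existsUnique_continuousMap_lifts
    RightHalfPlane.cosh h RightHalfPlane.two_lt_norm_cosh
  simpa only [funext_iff, Function.comp_apply, IsCoshLift] using this

theorem exists_isCoshLift
    (hcrit : ∀ z, T.derivative.IsRoot z → ‖T.eval z - 1‖ + ‖T.eval z + 1‖ ≤ 2)
    {z : ℂ} (hz : 2 < ‖T.eval z - 1‖ + ‖T.eval z + 1‖) :
    ∃ F, IsCoshLift T F ∧ z ∈ Set.range F := by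
  obtain ⟨s, hs⟩ := RightHalfPlane.exists_cosh_eq hz
  obtain ⟨F, ⟨hF, hF'⟩, -⟩ := existsUnique_isCoshLift hcrit hs.symm
  exact ⟨F, hF', s, hF⟩

theorem IsCoshLift.range_subset
    (hcrit : ∀ z, T.derivative.IsRoot z → ‖T.eval z - 1‖ + ‖T.eval z + 1‖ ≤ 2)
    {F G : C(RightHalfPlane, ℂ)} (hF : IsCoshLift T F) (hG : IsCoshLift T G)
    (h : (Set.range F ∩ Set.range G).Nonempty) : Set.range F ⊆ Set.range G := by
  obtain ⟨_, ⟨a, rfl⟩, ⟨b, hab⟩⟩ := h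
  have hc : RightHalfPlane.cosh a = RightHalfPlane.cosh b := by rw [← hF, ← hG, hab]
  obtain ⟨k, hk⟩ := RightHalfPlane.exists_eq_add_of_cosh_eq hc
  have hb : RightHalfPlane.shift k a = b := Subtype.ext hk.symm
  have heq : F = G.comp (RightHalfPlane.shift k) := by
    refine (existsUnique_isCoshLift hcrit (hF a)).unique ⟨rfl, hF⟩ ⟨?_, fun s ↦ ?_⟩
    · simp [hb, hab]
    · rw [ContinuousMap.comp_apply, hG, RightHalfPlane.cosh_shift]
  rintro _ ⟨s, rfl⟩
  exact ⟨RightHalfPlane.shift k s, by rw [heq]; rfl⟩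

theorem IsCoshLift.isOpen_range
    (hcrit : ∀ z, T.derivative.IsRoot z → ‖T.eval z - 1‖ + ‖T.eval z + 1‖ ≤ 2)
    {F : C(RightHalfPlane, ℂ)} (hF : IsCoshLift T F) : IsOpen (Set.range F) := by
  have hT := (isCoveringMapOn_eval_of_critical_values hcrit).isLocalHomeomorphOn
  have hcomp : (fun z ↦ T.eval z) ∘ F = RightHalfPlane.cosh := _root_.funext hF
  have hcosh := isLocalHomeomorph_iff_isLocalHomeomorphOn_univ.1
    RightHalfPlane.isLocalHomeomorph_cosh
  rw [← hcomp] at hcosh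
  have hloc := hcosh.of_comp_left (hT.mono ?_) fun s _ ↦ F.continuous.continuousAt
  · exact (isLocalHomeomorph_iff_isLocalHomeomorphOn_univ.2 hloc).isOpenMap.isOpen_range
  · rintro _ ⟨s, -, rfl⟩
    simpa [hF s] using RightHalfPlane.two_lt_norm_cosh s

theorem isPreconnected_setOf_lt_norm {R : ℝ} (hR : 0 < R) :
    IsPreconnected {z : ℂ | R < ‖z‖} := by
  have : {z : ℂ | R < ‖z‖} = Complex.exp '' {s : ℂ | Real.log R < s.re} := by
    ext z
    constructor
    · intro hz
      have hz' : R < ‖z‖ := hz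
      refine ⟨Complex.log z, ?_, Complex.exp_log (norm_pos_iff.1 (hR.trans hz'))⟩
      rw [Set.mem_ofPred_eq, Complex.log_re]
      exact Real.log_lt_log hR hz
    · rintro ⟨s, hs, rfl⟩
      rw [Set.mem_ofPred_eq, Complex.norm_exp]
      exact (Real.log_lt_iff_lt_exp hR).1 hs
  rw [this]
  exact (convex_halfSpace_re_gt _).isPreconnected.image _ Complex.continuous_exp.continuousOn

theorem isCompact_setOf_norm_eval_le (hT : 0 < T.natDegree) (r : ℝ) :
    IsCompact {z : ℂ | ‖T.eval z - 1‖ + ‖T.eval z + 1‖ ≤ r} := by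
  refine Metric.isCompact_of_isClosed_isBounded
    (isClosed_le (by fun_prop) continuous_const) ?_
  have h := T.tendsto_norm_atTop (natDegree_pos_iff_degree_pos.1 hT)
    (tendsto_norm_cobounded_atTop (E := ℂ))
  rw [Bornology.isBounded_def]
  filter_upwards [h.eventually_gt_atTop r] with z hz hz'
  have hle : ‖T.eval z - 1‖ + ‖T.eval z + 1‖ ≤ r := hz'
  have h2 : ‖2 * T.eval z‖ ≤ ‖T.eval z - 1‖ + ‖T.eval z + 1‖ := by
    rw [show 2 * T.eval z = (T.eval z - 1) + (T.eval z + 1) by ring]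
    exact norm_add_le _ _
  rw [norm_mul, Complex.norm_ofNat] at h2
  linarith [norm_nonneg (T.eval z)]

theorem IsCoshLift.mem_range (hT : 0 < T.natDegree)
    (hcrit : ∀ z, T.derivative.IsRoot z → ‖T.eval z - 1‖ + ‖T.eval z + 1‖ ≤ 2)
    {F : C(RightHalfPlane, ℂ)} (hF : IsCoshLift T F) {z : ℂ}
    (hz : 2 < ‖T.eval z - 1‖ + ‖T.eval z + 1‖) : z ∈ Set.range F := by
  obtain ⟨R, hR, hsub⟩ := (isCompact_setOf_norm_eval_le hT 2).isBounded.subset_closedBall_lt 0 0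
  have hlarge : ∀ y : ℂ, R < ‖y‖ → 2 < ‖T.eval y - 1‖ + ‖T.eval y + 1‖ := by
    intro y hy
    by_contra! h
    have := hsub h
    rw [mem_closedBall_zero_iff] at this
    linarith
  have hmeet : ∀ G, IsCoshLift T G → ({y : ℂ | R < ‖y‖} ∩ Set.range G).Nonempty := by
    intro G hG
    obtain ⟨M, hM⟩ := (isCompact_closedBall (0 : ℂ) R).exists_bound_of_continuousOn
      (f := T.eval) T.continuous.continuousOn
    have hu : 2 < ‖((|M| + 2 : ℝ) : ℂ) - 1‖ + ‖((|M| + 2 : ℝ) : ℂ) + 1‖ := by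
      rw [← not_le, norm_sub_one_add_norm_add_one_le_two_iff]
      rintro ⟨x, hx, hx'⟩
      have := Complex.ofReal_injective hx'
      linarith [hx.2, abs_nonneg M]
    obtain ⟨s, hs⟩ := RightHalfPlane.exists_cosh_eq hu
    refine ⟨G s, ?_, s, rfl⟩
    by_contra h
    have h1 := hM (G s) (by simpa using h)
    rw [hG, hs, Complex.norm_real, Real.norm_eq_abs] at h1
    linarith [le_abs_self M, le_abs_self (|M| + 2)]
  obtain ⟨G, hG, hzG⟩ := exists_isCoshLift hcrit hz
  suffices h : (Set.range G ∩ Set.range F).Nonempty from hG.range_subset hcrit hF h hzG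
  by_contra hne
  have hopen : IsOpen (⋃ H : {H // IsCoshLift T H ∧ ¬ (Set.range H ∩ Set.range F).Nonempty},
      Set.range H.1) := isOpen_iUnion fun H ↦ H.2.1.isOpen_range hcrit
  obtain ⟨y, -, hy1, hy2⟩ := isPreconnected_setOf_lt_norm hR _ _ (hF.isOpen_range hcrit) hopen
    (fun y hy ↦ by
      obtain ⟨H, hH, hyH⟩ := exists_isCoshLift hcrit (hlarge y hy)
      by_cases hHF : (Set.range H ∩ Set.range F).Nonempty
      · exact .inl (hH.range_subset hcrit hF hHF hyH)
      · exact .inr (Set.mem_iUnion.2 ⟨⟨H, hH, hHF⟩, hyH⟩))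
    (hmeet F hF)
    ((hmeet G hG).mono (Set.inter_subset_inter_right _
      (Set.subset_iUnion_of_subset ⟨G, hG, hne⟩ subset_rfl)))
  obtain ⟨H, hyH⟩ := Set.mem_iUnion.1 hy2
  exact H.2.2 ⟨y, hyH, hy1⟩

theorem isPreconnected_setOf_norm_eval_eq (hT : 0 < T.natDegree)
    (hcrit : ∀ z, T.derivative.IsRoot z → ‖T.eval z - 1‖ + ‖T.eval z + 1‖ ≤ 2)
    {r : ℝ} (hr : 2 < r) :
    IsPreconnected {z : ℂ | ‖T.eval z - 1‖ + ‖T.eval z + 1‖ = r} := by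
  rcases Set.eq_empty_or_nonempty {z : ℂ | ‖T.eval z - 1‖ + ‖T.eval z + 1‖ = r} with h | ⟨z, hz⟩
  · rw [h]; exact isPreconnected_empty
  have hz' : ‖T.eval z - 1‖ + ‖T.eval z + 1‖ = r := hz
  obtain ⟨F, hF, ⟨t, rfl⟩⟩ := exists_isCoshLift hcrit (hz'.symm ▸ hr)
  rw [hF, RightHalfPlane.cosh_apply, norm_cosh_sub_one_add] at hz'
  have : {z : ℂ | ‖T.eval z - 1‖ + ‖T.eval z + 1‖ = r} =
      Set.range fun y : ℝ ↦ F ⟨t.1.re + y * Complex.I, by simpa using t.2⟩ := by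
    ext z
    constructor
    · intro hz
      have hz2 : ‖T.eval z - 1‖ + ‖T.eval z + 1‖ = r := hz
      obtain ⟨s, rfl⟩ := hF.mem_range hT hcrit (hz2.symm ▸ hr)
      rw [hF, RightHalfPlane.cosh_apply, norm_cosh_sub_one_add] at hz2
      have hre : s.1.re = t.1.re := Real.cosh_strictMonoOn.injOn
        (Set.mem_Ici.2 s.2.le) (Set.mem_Ici.2 t.2.le) (by linarith)
      refine ⟨s.1.im, congrArg F (Subtype.ext ?_)⟩
      simp only [← hre, Complex.re_add_im]
    · rintro ⟨y, rfl⟩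
      rw [Set.mem_ofPred_eq, hF, RightHalfPlane.cosh_apply, norm_cosh_sub_one_add, ← hz']
      simp
  rw [this]
  exact isPreconnected_range (by fun_prop)

theorem disjoint_of_setOf_norm_eval_eq_subset (hT : 0 < T.natDegree) {r : ℝ} {U V : Set ℂ}
    (hU : IsOpen U) (hV : IsOpen V) (hUV : Disjoint U V)
    (hcover : {z : ℂ | ‖T.eval z - 1‖ + ‖T.eval z + 1‖ ≤ r} ⊆ U ∪ V)
    (hlevel : {z : ℂ | ‖T.eval z - 1‖ + ‖T.eval z + 1‖ = r} ⊆ U) :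
    Disjoint {z : ℂ | ‖T.eval z - 1‖ + ‖T.eval z + 1‖ ≤ r} V := by
  set L := {z : ℂ | ‖T.eval z - 1‖ + ‖T.eval z + 1‖ ≤ r}
  have h1 : L ∩ V = {z : ℂ | ‖T.eval z - 1‖ + ‖T.eval z + 1‖ < r} ∩ V := by
    ext z
    constructor
    · rintro ⟨hz, hzV⟩
      have hne : ‖T.eval z - 1‖ + ‖T.eval z + 1‖ ≠ r := fun he ↦
        Set.disjoint_left.1 hUV (hlevel he) hzV
      exact ⟨lt_of_le_of_ne (show _ ≤ r from hz) hne, hzV⟩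
    · rintro ⟨hz, hzV⟩
      exact ⟨(show _ < r from hz).le, hzV⟩
  have h2 : L ∩ V = L \ U := by
    ext z
    exact ⟨fun ⟨hz, hzV⟩ ↦ ⟨hz, fun hzU ↦ Set.disjoint_left.1 hUV hzU hzV⟩,
      fun ⟨hz, hzU⟩ ↦ ⟨hz, (hcover hz).resolve_left hzU⟩⟩
  have hL := isCompact_setOf_norm_eval_le hT r
  have hcompact : IsCompact (L ∩ V) := h2 ▸ hL.diff hU
  have hopen : IsOpen (L ∩ V) := h1 ▸ (isOpen_lt (by fun_prop) continuous_const).inter hV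
  rw [Set.disjoint_iff_inter_eq_empty]
  rcases isClopen_iff.1 ⟨hcompact.isClosed, hopen⟩ with h | h
  · exact h
  · exact absurd (h ▸ hcompact) (noncompact_univ ℂ)

/-- If all critical values of a nonconstant complex polynomial lie in `[-1, 1]`, then the inverse
image of `[-1, 1]` is connected. -/
theorem isPreconnected_setOf_norm_eval_le_two (hT : 0 < T.natDegree)
    (hcrit : ∀ z, T.derivative.IsRoot z → ‖T.eval z - 1‖ + ‖T.eval z + 1‖ ≤ 2) :
    IsPreconnected {z : ℂ | ‖T.eval z - 1‖ + ‖T.eval z + 1‖ ≤ 2} := by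
  have hK := isCompact_setOf_norm_eval_le hT 2
  rw [isPreconnected_iff_subset_of_fully_disjoint_closed hK.isClosed]
  intro A B hA hB hcov hAB
  obtain ⟨U, V, hU, hV, hAU, hBV, hUV⟩ := normal_separation hA hB hAB
  obtain ⟨r, hr, hLr⟩ : ∃ r : ℝ, 2 < r ∧
      {z : ℂ | ‖T.eval z - 1‖ + ‖T.eval z + 1‖ ≤ r} ⊆ U ∪ V := by
    have hM : IsCompact ({z : ℂ | ‖T.eval z - 1‖ + ‖T.eval z + 1‖ ≤ 3} \ (U ∪ V)) :=
      (isCompact_setOf_norm_eval_le hT 3).diff (hU.union hV)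
    rcases Set.eq_empty_or_nonempty
      ({z : ℂ | ‖T.eval z - 1‖ + ‖T.eval z + 1‖ ≤ 3} \ (U ∪ V)) with he | hne
    · exact ⟨3, by norm_num, Set.sdiff_eq_empty.1 he⟩
    obtain ⟨z, hz, hmin⟩ := hM.exists_isMinOn hne
      (f := fun z ↦ ‖T.eval z - 1‖ + ‖T.eval z + 1‖) (by fun_prop)
    have h2 : 2 < ‖T.eval z - 1‖ + ‖T.eval z + 1‖ := by
      by_contra! h
      exact hz.2 ((hcov h).imp (@hAU z) (@hBV z))
    obtain ⟨r, hr1, hr2⟩ := exists_between h2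
    refine ⟨r, hr1, fun y hy ↦ ?_⟩
    by_contra hyUV
    have hy' : ‖T.eval y - 1‖ + ‖T.eval y + 1‖ ≤ r := hy
    have h3 : ‖T.eval z - 1‖ + ‖T.eval z + 1‖ ≤ 3 := hz.1
    have := hmin ⟨(by linarith : ‖T.eval y - 1‖ + ‖T.eval y + 1‖ ≤ 3), hyUV⟩
    simp only [Set.mem_ofPred_eq] at this
    linarith
  have hKL : ∀ z, ‖T.eval z - 1‖ + ‖T.eval z + 1‖ ≤ 2 →
      z ∈ {z : ℂ | ‖T.eval z - 1‖ + ‖T.eval z + 1‖ ≤ r} := fun z hz ↦ hz.trans hr.le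
  have hlevel := isPreconnected_iff_subset_of_disjoint.1
    (isPreconnected_setOf_norm_eval_eq hT hcrit hr) U V hU hV
    (subset_trans (fun z hz ↦ le_of_eq hz) hLr) (by rw [hUV.inter_eq, Set.inter_empty])
  refine hlevel.imp (fun h z hz ↦ ?_) fun h z hz ↦ ?_
  · have hd := disjoint_of_setOf_norm_eval_eq_subset hT hU hV hUV hLr h
    exact (hcov hz).resolve_right fun hzB ↦ Set.disjoint_left.1 hd (hKL z hz) (hBV hzB)
  · have hd := disjoint_of_setOf_norm_eval_eq_subset hT hV hU hUV.symm
      (Set.union_comm U V ▸ hLr) h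
    exact (hcov hz).resolve_left fun hzA ↦ Set.disjoint_left.1 hd (hKL z hz) (hAU hzA)

end Polynomial

theorem stmt_11 (n ν : ℕ) (hn : 1 ≤ n) (hν : 2 ≤ ν) (hnν : 2 * ν - 3 ≤ n)
    (c : Fin ν → ℂ) (d : Fin (ν - 2) → ℂ) (w : Fin (n + 3 - 2 * ν) → ℂ)
    (hdist : Function.Injective (Sum.elim c (Sum.elim d w)))
    (τ : ℂ) (hτ : τ ≠ 0) (T : Polynomial ℂ)
    (hdeg : T.natDegree = n) (hlc : T.leadingCoeff = τ)
    (hfac : T ^ 2 - 1 = Polynomial.C (τ ^ 2) *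
        (∏ j : Fin ν, (Polynomial.X - Polynomial.C (c j))) *
        (∏ j : Fin (ν - 2), (Polynomial.X - Polynomial.C (d j)) ^ 3) *
        (∏ j : Fin (n + 3 - 2 * ν), (Polynomial.X - Polynomial.C (w j)) ^ 2)) :
    Polynomial.derivative T = Polynomial.C ((n : ℂ) * τ) *
        (∏ j : Fin (ν - 2), (Polynomial.X - Polynomial.C (d j)) ^ 2) *
        (∏ j : Fin (n + 3 - 2 * ν), (Polynomial.X - Polynomial.C (w j))) ∧
      (∀ z₀ : ℂ, (Polynomial.derivative T).IsRoot z₀ →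
        z₀ ∈ {z : ℂ | ∃ x : ℝ, x ∈ Set.Icc (-1 : ℝ) 1 ∧ Polynomial.eval z T = (x : ℂ)}) ∧
      IsConnected {z : ℂ | ∃ x : ℝ, x ∈ Set.Icc (-1 : ℝ) 1 ∧ Polynomial.eval z T = (x : ℂ)} := by
  have hnν' : 2 * (ν - 2) + (n + 3 - 2 * ν) + 1 = n := by omega
  have hder : derivative T = C ((n : ℂ) * τ) * (∏ j, (X - C (d j))) ^ 2 * ∏ j, (X - C (w j)) := by
    rw [← hlc]
    refine derivative_eq_of_sq_sub_one_eq (Q := C (τ ^ 2) * ∏ j, (X - C (c j))) hdeg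
      (monic_prod_X_sub_C _ _) (monic_prod_X_sub_C _ _) ?_ ?_
    · simpa [natDegree_finsetProd_X_sub_C_eq_card] using hnν'
    · rw [hfac, Finset.prod_pow, Finset.prod_pow]
  have hend (z : ℂ) (hz : T.eval z ^ 2 - 1 = 0) :
      ∃ x : ℝ, x ∈ Set.Icc (-1 : ℝ) 1 ∧ T.eval z = x := by
    rcases sq_eq_one_iff.1 (sub_eq_zero.1 hz) with h | h
    · exact ⟨1, by norm_num, by simpa using h⟩
    · exact ⟨-1, by norm_num, by simpa using h⟩
  have hfac' (z : ℂ) := congrArg (eval z) hfac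
  simp only [eval_sub, eval_pow, eval_one, eval_mul, eval_C, eval_prod, eval_X] at hfac'
  have hroot (z : ℂ) (hz : (derivative T).IsRoot z) :
      ∃ x : ℝ, x ∈ Set.Icc (-1 : ℝ) 1 ∧ T.eval z = x := by
    refine hend z ?_
    rw [hfac', Finset.prod_pow, Finset.prod_pow]
    have hn0 : (n : ℂ) ≠ 0 := by exact_mod_cast (by omega : n ≠ 0)
    have := hder ▸ hz
    simp only [IsRoot.def, eval_mul, eval_pow, eval_C, eval_prod, eval_sub, eval_X,
      mul_eq_zero, hn0, hτ, false_or, pow_eq_zero_iff two_ne_zero] at this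
    rcases this with h | h <;> simp [h]
  refine ⟨by rw [hder, Finset.prod_pow], hroot, ⟨c ⟨0, by omega⟩, hend _ ?_⟩, ?_⟩
  · rw [hfac', Finset.prod_eq_zero (Finset.mem_univ (⟨0, by omega⟩ : Fin ν)) (by simp)]
    simp
  · simp only [← norm_sub_one_add_norm_add_one_le_two_iff] at hroot ⊢
    exact isPreconnected_setOf_norm_eval_le_two (by omega) hroot
end

section
/- Let α ≥ 0 be a real number and let T(z) = (2/(1 + α²))·(z² − 1) + 1. Then the inverse image {z ∈ ℂ : T(z) ∈ [−1, 1]} equals the cross [−1, 1] ∪ [−iα, iα], i.e. the union of the real segment {x ∈ ℝ : −1 ≤ x ≤ 1} ⊆ ℂ and the imaginary segment {iy : y ∈ ℝ, −α ≤ y ≤ α} ⊆ ℂ. -/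
open Polynomial Complex

theorem stmt_13 (α : ℝ) (hα : 0 ≤ α)
    (T : Polynomial ℂ)
    (hT : T = Polynomial.C ((2 : ℂ) / (1 + (α : ℂ) ^ 2)) * (Polynomial.X ^ 2 - 1) + 1) :
    {z : ℂ | ∃ x : ℝ, x ∈ Set.Icc (-1 : ℝ) 1 ∧ Polynomial.eval z T = (x : ℂ)} =
      ((fun x : ℝ => (x : ℂ)) '' Set.Icc (-1 : ℝ) 1) ∪
        ((fun y : ℝ => (y : ℂ) * Complex.I) '' Set.Icc (-α) α) := by
  have hpos : 0 < 1 + α ^ 2 := by positivity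
  have hne : (1 + (α : ℂ) ^ 2) ≠ 0 := by exact_mod_cast hpos.ne'
  have heval (z : ℂ) : Polynomial.eval z T = 2 / (1 + (α : ℂ) ^ 2) * (z ^ 2 - 1) + 1 := by
    simp [hT]
  have hreal (r : ℝ) (h₁ : -α ^ 2 ≤ r) (h₂ : r ≤ 1) :
      2 / (1 + α ^ 2) * (r - 1) + 1 ∈ Set.Icc (-1 : ℝ) 1 := by
    have e : 2 / (1 + α ^ 2) * (r - 1) + 1 = (2 * (r - 1) + (1 + α ^ 2)) / (1 + α ^ 2) := by
      field_simp
    rw [e, Set.mem_Icc, le_div_iff₀ hpos, div_le_iff₀ hpos]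
    constructor <;> linarith
  ext z
  simp only [Set.mem_ofPred_eq, Set.mem_union, Set.mem_image, heval]
  constructor
  · rintro ⟨x, ⟨hx₁, hx₂⟩, hx⟩
    have hsq : z ^ 2 = ((1 + (x - 1) * (1 + α ^ 2) / 2 : ℝ) : ℂ) := by
      push_cast
      rw [← hx]
      field_simp
      ring
    have hre : z.re ^ 2 - z.im ^ 2 = 1 + (x - 1) * (1 + α ^ 2) / 2 := by
      have h := congrArg Complex.re hsq
      rw [Complex.ofReal_re] at h
      rw [← h, sq z, Complex.mul_re]
      ring
    have him : z.re * z.im = 0 := by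
      have h := congrArg Complex.im hsq
      rw [Complex.ofReal_im, sq z, Complex.mul_im] at h
      linarith
    rcases mul_eq_zero.mp him with h | h
    · refine Or.inr ⟨z.im, ?_, by apply Complex.ext <;> simp [h]⟩
      rw [h] at hre
      exact abs_le.mp (abs_le_of_sq_le_sq (by nlinarith) hα)
    · refine Or.inl ⟨z.re, ?_, by apply Complex.ext <;> simp [h]⟩
      rw [h] at hre
      exact abs_le.mp (abs_le_of_sq_le_sq (by nlinarith) zero_le_one)
  · rintro (⟨x, ⟨h₁, h₂⟩, rfl⟩ | ⟨y, ⟨h₁, h₂⟩, rfl⟩)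
    · refine ⟨_, hreal (x ^ 2) (by nlinarith) (by nlinarith), ?_⟩
      push_cast
      rfl
    · refine ⟨_, hreal (-y ^ 2) (by nlinarith) (by nlinarith), ?_⟩
      push_cast
      rw [mul_pow, Complex.I_sq]
      ring
end

section
/- Let α be a real number with 0 ≤ α ≤ √3 and define the cubic polynomial T(z) = −1 − (z − 1)(2z + 1 − α²)²/(1 + α²)². Then the zeros of the derivative T′ are (α² − 1)/2 and (3 + α²)/6, both of which lie in T⁻¹([−1,1]), and the inverse image {z ∈ ℂ : T(z) ∈ [−1, 1]} is connected. -/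
open Polynomial Complex

/-- The cubic `p ↦ p (2 p - b) ^ 2` takes values in `[0, 2 (4 - b) ^ 2]` at `p = x + i y`:
the real-variable description of the inverse image, in terms of `1 - z`. -/
def cubicPreimage (b : ℝ) : Set (ℝ × ℝ) :=
  {p | p.2 * (12 * p.1 ^ 2 - 4 * p.2 ^ 2 - 8 * b * p.1 + b ^ 2) = 0 ∧
    0 ≤ 4 * p.1 ^ 3 - 12 * p.1 * p.2 ^ 2 - 4 * b * (p.1 ^ 2 - p.2 ^ 2) + b ^ 2 * p.1 ∧
    4 * p.1 ^ 3 - 12 * p.1 * p.2 ^ 2 - 4 * b * (p.1 ^ 2 - p.2 ^ 2) + b ^ 2 * p.1 ≤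
      2 * (4 - b) ^ 2}

lemma mk_zero_mem_cubicPreimage {b : ℝ} (hb3 : b ≤ 3) {x : ℝ}
    (hx : x ∈ Set.Icc (0 : ℝ) 2) : (x, (0 : ℝ)) ∈ cubicPreimage b := by
  obtain ⟨h0, h2⟩ := hx
  refine ⟨by simp, ?_, ?_⟩
  · have := mul_nonneg h0 (sq_nonneg (2 * x - b))
    dsimp only
    linarith
  · have : 0 ≤ (2 - x) * ((2 * x + 2 - b) ^ 2 + (12 - 4 * b)) :=
      mul_nonneg (by linarith) (by nlinarith [sq_nonneg (2 * x + 2 - b)])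
    dsimp only
    linarith

lemma mem_Icc_of_mk_zero_mem_cubicPreimage {b : ℝ} (hb0 : 0 ≤ b) (hb3 : b ≤ 3) {x : ℝ}
    (hx : (x, (0 : ℝ)) ∈ cubicPreimage b) : x ∈ Set.Icc (0 : ℝ) 2 := by
  obtain ⟨-, h0, h2⟩ := hx
  dsimp only at h0 h2
  constructor
  · by_contra! h
    have : 0 < (-x) * (2 * x - b) ^ 2 :=
      mul_pos (by linarith) (sq_pos_of_neg (by linarith))
    linarith
  · by_contra! h
    have : 0 < (x - 2) * ((2 * x + 2 - b) ^ 2 + (12 - 4 * b)) :=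
      mul_pos (by linarith) (by nlinarith)
    linarith

/-- A non-real point of the preimage lies on the left branch of a hyperbola. -/
lemma le_of_mem_cubicPreimage {b : ℝ} (hb0 : 0 ≤ b) {x y : ℝ} (hy : y ≠ 0)
    (h : (x, y) ∈ cubicPreimage b) :
    4 * y ^ 2 = (b - 6 * x) * (b - 2 * x) ∧ x ≤ b / 6 ∧
      (b - 2 * x) * (b - 4 * x) ^ 2 ≤ 2 * (4 - b) ^ 2 := by
  obtain ⟨h1, h0, h2⟩ := h
  dsimp only at h1 h0 h2
  have hq : 4 * y ^ 2 = (b - 6 * x) * (b - 2 * x) := by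
    have := (mul_eq_zero.1 h1).resolve_left hy
    linarith
  have hv : 4 * x ^ 3 - 12 * x * y ^ 2 - 4 * b * (x ^ 2 - y ^ 2) + b ^ 2 * x =
      (b - 2 * x) * (b - 4 * x) ^ 2 := by
    linear_combination (b - 3 * x) * hq
  rw [hv] at h0 h2
  refine ⟨hq, ?_, h2⟩
  have hy2 : 0 < (b - 6 * x) * (b - 2 * x) := by
    have := pow_pos (abs_pos.2 hy) 2
    rw [sq_abs] at this
    linarith
  by_contra! h
  have hbx : b - 2 * x < 0 := by
    by_contra! h'
    nlinarith
  have h4 : 0 < (b - 4 * x) ^ 2 := sq_pos_of_neg (by linarith)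
  nlinarith

lemma mk_mem_cubicPreimage {b : ℝ} {x y : ℝ} (hb0 : 0 ≤ b)
    (hq : 4 * y ^ 2 = (b - 6 * x) * (b - 2 * x)) (hx : x ≤ b / 6)
    (h : (b - 2 * x) * (b - 4 * x) ^ 2 ≤ 2 * (4 - b) ^ 2) : (x, y) ∈ cubicPreimage b := by
  have hv : 4 * x ^ 3 - 12 * x * y ^ 2 - 4 * b * (x ^ 2 - y ^ 2) + b ^ 2 * x =
      (b - 2 * x) * (b - 4 * x) ^ 2 := by
    linear_combination (b - 3 * x) * hq
  refine ⟨?_, ?_, ?_⟩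
  · dsimp only
    linear_combination -y * hq
  · dsimp only
    rw [hv]
    exact mul_nonneg (by linarith) (sq_nonneg _)
  · dsimp only
    rwa [hv]

lemma isPreconnected_cubicPreimage {b : ℝ} (hb0 : 0 ≤ b) (hb3 : b ≤ 3) :
    IsPreconnected (cubicPreimage b) := by
  refine isPreconnected_of_forall (b / 6, (0 : ℝ)) ?_
  rintro ⟨x, y⟩ hxy
  by_cases hy : y = 0
  · subst hy
    refine ⟨(fun t : ℝ => (t, (0 : ℝ))) '' Set.Icc 0 2, ?_, ?_, ?_, ?_⟩
    · rintro _ ⟨t, ht, rfl⟩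
      exact mk_zero_mem_cubicPreimage hb3 ht
    · exact ⟨b / 6, ⟨by linarith, by linarith⟩, rfl⟩
    · exact ⟨x, mem_Icc_of_mk_zero_mem_cubicPreimage hb0 hb3 hxy, rfl⟩
    · exact isPreconnected_Icc.image _ (by fun_prop)
  · obtain ⟨hq, hx, hv⟩ := le_of_mem_cubicPreimage hb0 hy hxy
    obtain ⟨ε, hε, hyε⟩ : ∃ ε : ℝ, ε ^ 2 = 1 ∧ y = ε * |y| := by
      rcases abs_cases y with h | h
      · exact ⟨1, by norm_num, by linarith [h.1]⟩
      · exact ⟨-1, by norm_num, by linarith [h.1]⟩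
    refine ⟨(fun t : ℝ => (t, ε * √((b - 6 * t) * (b - 2 * t) / 4))) '' Set.Icc x (b / 6),
      ?_, ?_, ?_, ?_⟩
    · rintro _ ⟨t, ⟨hxt, ht⟩, rfl⟩
      refine mk_mem_cubicPreimage hb0 ?_ ht (le_trans ?_ hv)
      · have : 0 ≤ (b - 6 * t) * (b - 2 * t) / 4 :=
          div_nonneg (mul_nonneg (by linarith) (by linarith)) (by norm_num)
        rw [mul_pow, hε, Real.sq_sqrt this]
        ring
      · have h4 : 0 ≤ b - 4 * t := by linarith
        have h2 : 0 ≤ b - 2 * x := by linarith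
        gcongr
    · refine ⟨b / 6, ⟨hx, le_rfl⟩, ?_⟩
      simp [mul_div_cancel₀]
    · refine ⟨x, ⟨le_rfl, hx⟩, ?_⟩
      have : (b - 6 * x) * (b - 2 * x) / 4 = y ^ 2 := by linarith
      simp only [this, Real.sqrt_sq_eq_abs, ← hyε]
    · exact isPreconnected_Icc.image _ (by fun_prop)

theorem stmt_14 (α : ℝ) (hα0 : 0 ≤ α) (hα3 : α ≤ Real.sqrt 3)
    (T : Polynomial ℂ)
    (hT : T = -1 - Polynomial.C (((1 : ℂ) + (α : ℂ) ^ 2) ^ 2)⁻¹ *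
        ((Polynomial.X - 1) * (2 * Polynomial.X + Polynomial.C (1 - (α : ℂ) ^ 2)) ^ 2)) :
    (∀ z₀ : ℂ, (Polynomial.derivative T).IsRoot z₀ ↔
        z₀ = (((α : ℂ) ^ 2 - 1) / 2) ∨ z₀ = ((3 + (α : ℂ) ^ 2) / 6)) ∧
      (((α : ℂ) ^ 2 - 1) / 2 ∈
        {z : ℂ | ∃ x : ℝ, x ∈ Set.Icc (-1 : ℝ) 1 ∧ Polynomial.eval z T = (x : ℂ)}) ∧
      ((3 + (α : ℂ) ^ 2) / 6 ∈
        {z : ℂ | ∃ x : ℝ, x ∈ Set.Icc (-1 : ℝ) 1 ∧ Polynomial.eval z T = (x : ℂ)}) ∧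
      IsConnected {z : ℂ | ∃ x : ℝ, x ∈ Set.Icc (-1 : ℝ) 1 ∧ Polynomial.eval z T = (x : ℂ)} := by
  have ha3 : α ^ 2 ≤ 3 := by
    calc α ^ 2 ≤ √3 ^ 2 := by gcongr
      _ = 3 := Real.sq_sqrt (by norm_num)
  have hcR : (0 : ℝ) < (1 + α ^ 2) ^ 2 := by positivity
  have hc : ((1 : ℂ) + (α : ℂ) ^ 2) ^ 2 ≠ 0 := by exact_mod_cast hcR.ne'
  set S := {z : ℂ | ∃ x : ℝ, x ∈ Set.Icc (-1 : ℝ) 1 ∧ Polynomial.eval z T = (x : ℂ)} with hS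
  have hmem (x y : ℝ) : (1 - (x + y * I) : ℂ) ∈ S ↔ (x, y) ∈ cubicPreimage (3 - α ^ 2) := by
    set u := 4 * x ^ 3 - 12 * x * y ^ 2 - 4 * (3 - α ^ 2) * (x ^ 2 - y ^ 2) +
      (3 - α ^ 2) ^ 2 * x with hu
    set v := y * (12 * x ^ 2 - 4 * y ^ 2 - 8 * (3 - α ^ 2) * x + (3 - α ^ 2) ^ 2) with hv
    have key : eval (1 - (x + y * I) : ℂ) T =
        ((-1 + u / (1 + α ^ 2) ^ 2 : ℝ) : ℂ) + ((v / (1 + α ^ 2) ^ 2 : ℝ) : ℂ) * I := by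
      have hI3 : I ^ 3 = -I := by rw [pow_succ, I_sq]; ring
      rw [hT, hu, hv]
      simp only [eval_sub, eval_neg, eval_one, eval_mul, eval_C, eval_X, eval_pow, eval_add,
        eval_ofNat]
      push_cast
      field_simp
      ring_nf
      simp only [I_sq, hI3]
      ring
    have hmem' : (x, y) ∈ cubicPreimage (3 - α ^ 2) ↔
        v = 0 ∧ 0 ≤ u ∧ u ≤ 2 * (1 + α ^ 2) ^ 2 := by
      rw [show (1 + α ^ 2) = 4 - (3 - α ^ 2) by ring]
      rfl
    rw [hmem', hS, Set.mem_ofPred_eq, key]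
    constructor
    · rintro ⟨t, ⟨ht1, ht2⟩, h⟩
      have hre := congrArg re h
      have him := congrArg im h
      simp only [add_re, add_im, re_ofReal_mul, im_ofReal_mul, ofReal_re, ofReal_im, I_re, I_im,
        mul_zero, mul_one, add_zero, zero_add] at hre him
      have hu2 : u / (1 + α ^ 2) ^ 2 = t + 1 := by linarith
      rw [div_eq_iff hcR.ne'] at hu2
      refine ⟨(div_eq_zero_iff.1 him).resolve_right hcR.ne', ?_, ?_⟩
      · rw [hu2]
        exact mul_nonneg (by linarith) hcR.le
      · rw [hu2]
        gcongr
        linarith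
    · rintro ⟨h0, h1, h2⟩
      refine ⟨-1 + u / (1 + α ^ 2) ^ 2, ⟨?_, ?_⟩, ?_⟩
      · have : 0 ≤ u / (1 + α ^ 2) ^ 2 := by positivity
        linarith
      · have : u / (1 + α ^ 2) ^ 2 ≤ 2 := (div_le_iff₀ hcR).2 h2
        linarith
      · simp [h0]
  have hpre : S = (fun p : ℝ × ℝ => (1 - (p.1 + p.2 * I) : ℂ)) '' cubicPreimage (3 - α ^ 2) := by
    ext z
    constructor
    · intro hz
      have hz' : (1 - (((1 - z.re : ℝ) : ℂ) + ((-z.im : ℝ) : ℂ) * I)) = z := by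
        apply Complex.ext <;> simp
      exact ⟨(1 - z.re, -z.im), (hmem _ _).1 (by rwa [hz']), hz'⟩
    · rintro ⟨⟨x, y⟩, h, rfl⟩
      exact (hmem x y).2 h
  have hreal (x : ℝ) (hx : x ∈ Set.Icc (0 : ℝ) 2) : (1 - x : ℂ) ∈ S := by
    simpa using (hmem x 0).2 (mk_zero_mem_cubicPreimage (by nlinarith) hx)
  have hcrit₂ : (3 + (α : ℂ) ^ 2) / 6 ∈ S := by
    have := hreal ((3 - α ^ 2) / 6) ⟨by linarith, by nlinarith⟩
    convert this using 1
    push_cast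
    ring
  refine ⟨fun z => ?_, ?_, hcrit₂, ⟨_, hcrit₂⟩, ?_⟩
  · have hder : eval z (derivative T) =
        -(((1 : ℂ) + (α : ℂ) ^ 2) ^ 2)⁻¹ * ((2 * z + 1 - α ^ 2) * (6 * z - 3 - α ^ 2)) := by
      rw [hT]
      simp [derivative_pow]
      exact Or.inl (by ring)
    rw [IsRoot.def, hder, mul_eq_zero, or_iff_right (neg_ne_zero.2 (inv_ne_zero hc)), mul_eq_zero]
    refine or_congr ⟨fun h => ?_, fun h => ?_⟩ ⟨fun h => ?_, fun h => ?_⟩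
    · linear_combination h / 2
    · linear_combination 2 * h
    · linear_combination h / 6
    · linear_combination 6 * h
  · have := hreal ((3 - α ^ 2) / 2) ⟨by linarith, by nlinarith⟩
    convert this using 1
    push_cast
    ring
  · rw [hpre]
    exact (isPreconnected_cubicPreimage (by linarith) (by nlinarith)).image _ (by fun_prop)
end

section
/- Let α ≥ 0 be a real number and define the quartic polynomial T(z) = (8z⁴ − 8z² + 1 + 4α²)/(1 + 4α²). Then the zeros of the derivative T′ are 0, 1/√2 and −1/√2, all of which lie in T⁻¹([−1,1]), and the inverse image {z ∈ ℂ : T(z) ∈ [−1, 1]} is connected. -/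
open Polynomial Complex

/-- The square-root image `{u | u ^ 2 ∈ [a, b]}` of a real segment containing `0` is star convex. -/
lemma starConvex_setOf_sq_mem_Icc {a b : ℝ} (ha : a ≤ 0) (hb : 0 ≤ b) :
    StarConvex ℝ (0 : ℂ) {u : ℂ | ∃ s ∈ Set.Icc a b, u ^ 2 = (s : ℂ)} := by
  rw [starConvex_zero_iff]
  rintro u ⟨s, ⟨hs₁, hs₂⟩, hu⟩ t ht₀ ht₁
  have ht : t ^ 2 ≤ 1 := pow_le_one₀ ht₀ ht₁
  refine ⟨t ^ 2 * s, ⟨by nlinarith [sq_nonneg t], by nlinarith [sq_nonneg t]⟩, ?_⟩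
  rw [Complex.real_smul, mul_pow, hu]
  push_cast
  rfl

lemma neg_one_le_re_of_sq_eq {u : ℂ} {s : ℝ} (hs : s ≤ 1) (hu : u ^ 2 = (s : ℂ)) :
    -1 ≤ u.re := by
  have hre := congrArg Complex.re hu
  have him := congrArg Complex.im hu
  simp only [sq, Complex.mul_re, Complex.mul_im, Complex.ofReal_re, Complex.ofReal_im] at hre him
  have h : u.re * u.im = 0 := by linarith
  rcases mul_eq_zero.mp h with h | h
  · linarith
  · rw [h] at hre
    nlinarith

/-- The preimage under `z ↦ 2 z ^ 2 - 1` of a preconnected set containing `-1` and contained in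
the half-plane `-1 ≤ re` is connected. -/
lemma isConnected_preimage_two_mul_sq_sub_one {K : Set ℂ} (hK : IsPreconnected K)
    (h_mem : -1 ∈ K) (hre : ∀ u ∈ K, -1 ≤ u.re) :
    IsConnected {z : ℂ | 2 * z ^ 2 - 1 ∈ K} := by
  set f : ℂ → ℂ := fun u => ((1 + u) / 2) ^ ((2 : ℕ) : ℂ)⁻¹ with hf
  have hsq (u : ℂ) : f u ^ 2 = (1 + u) / 2 := Complex.cpow_nat_inv_pow _ two_ne_zero
  have hcont : ContinuousOn f K := by
    intro u hu
    have hp : 0 ≤ ((1 + u) / 2).re := by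
      have := hre u hu
      simp only [Complex.div_ofNat_re, Complex.add_re, Complex.one_re]
      linarith
    have hc := Complex.continuousAt_cpow_of_re_pos (p := ((1 + u) / 2, ((2 : ℕ) : ℂ)⁻¹))
      (Or.inl hp) (by norm_num)
    exact (ContinuousAt.comp (f := fun u : ℂ => ((1 + u) / 2, ((2 : ℕ) : ℂ)⁻¹)) hc
      (by fun_prop)).continuousWithinAt
  have h_zero : f (-1) = 0 := pow_eq_zero_iff two_ne_zero |>.mp (by rw [hsq]; norm_num)
  have h_eq : {z : ℂ | 2 * z ^ 2 - 1 ∈ K} = f '' K ∪ (fun u => -f u) '' K := by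
    ext z
    constructor
    · intro hz
      have : z ^ 2 = f (2 * z ^ 2 - 1) ^ 2 := by rw [hsq]; ring
      rcases sq_eq_sq_iff_eq_or_eq_neg.mp this with h | h
      · exact Or.inl ⟨_, hz, h.symm⟩
      · exact Or.inr ⟨_, hz, h.symm⟩
    · rintro (⟨u, hu, rfl⟩ | ⟨u, hu, rfl⟩)
      · have : 2 * f u ^ 2 - 1 = u := by rw [hsq]; ring
        simpa only [Set.mem_ofPred_eq, this] using hu
      · have : 2 * (-f u) ^ 2 - 1 = u := by rw [neg_sq, hsq]; ring
        simpa only [Set.mem_ofPred_eq, this] using hu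
  rw [h_eq]
  exact ⟨⟨0, Or.inl ⟨-1, h_mem, h_zero⟩⟩,
    (hK.image f hcont).union 0 ⟨-1, h_mem, h_zero⟩ ⟨-1, h_mem, by simp [h_zero]⟩
      (hK.image _ hcont.neg)⟩

theorem stmt_15 (α : ℝ) (hα : 0 ≤ α)
    (T : Polynomial ℂ)
    (hT : T = Polynomial.C ((1 : ℂ) + 4 * (α : ℂ) ^ 2)⁻¹ *
        (8 * Polynomial.X ^ 4 - 8 * Polynomial.X ^ 2 +
          Polynomial.C (1 + 4 * (α : ℂ) ^ 2))) :
    (∀ z₀ : ℂ, (Polynomial.derivative T).IsRoot z₀ ↔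
        z₀ = 0 ∨ z₀ = ((Real.sqrt 2 : ℝ) : ℂ)⁻¹ ∨ z₀ = -((Real.sqrt 2 : ℝ) : ℂ)⁻¹) ∧
      ((0 : ℂ) ∈ {z : ℂ | ∃ x : ℝ, x ∈ Set.Icc (-1 : ℝ) 1 ∧ Polynomial.eval z T = (x : ℂ)}) ∧
      (((Real.sqrt 2 : ℝ) : ℂ)⁻¹ ∈
        {z : ℂ | ∃ x : ℝ, x ∈ Set.Icc (-1 : ℝ) 1 ∧ Polynomial.eval z T = (x : ℂ)}) ∧
      (-((Real.sqrt 2 : ℝ) : ℂ)⁻¹ ∈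
        {z : ℂ | ∃ x : ℝ, x ∈ Set.Icc (-1 : ℝ) 1 ∧ Polynomial.eval z T = (x : ℂ)}) ∧
      IsConnected {z : ℂ | ∃ x : ℝ, x ∈ Set.Icc (-1 : ℝ) 1 ∧ Polynomial.eval z T = (x : ℂ)} := by
  have hc : (1 : ℝ) ≤ 1 + 4 * α ^ 2 := by nlinarith [sq_nonneg α]
  have hc_ne : (1 : ℂ) + 4 * (α : ℂ) ^ 2 ≠ 0 := by
    have : (1 + 4 * α ^ 2 : ℝ) ≠ 0 := by linarith
    exact_mod_cast this
  have h_eval (z : ℂ) : T.eval z =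
      (1 + 4 * (α : ℂ) ^ 2)⁻¹ * (8 * z ^ 4 - 8 * z ^ 2 + (1 + 4 * (α : ℂ) ^ 2)) := by
    simp [hT]
  have h_sqrt : ((√2 : ℝ) : ℂ)⁻¹ ^ 2 = 1 / 2 := by
    rw [inv_pow, ← Complex.ofReal_pow, Real.sq_sqrt zero_le_two]
    norm_num
  have h_set : {z : ℂ | ∃ x : ℝ, x ∈ Set.Icc (-1 : ℝ) 1 ∧ Polynomial.eval z T = (x : ℂ)} =
      {z : ℂ | 2 * z ^ 2 - 1 ∈
        {u : ℂ | ∃ s ∈ Set.Icc (-(4 * α ^ 2) : ℝ) 1, u ^ 2 = (s : ℂ)}} := by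
    ext z
    simp only [Set.mem_ofPred_eq, h_eval]
    constructor
    · rintro ⟨x, ⟨hx₁, hx₂⟩, hx⟩
      rw [inv_mul_eq_iff_eq_mul₀ hc_ne] at hx
      refine ⟨1 + (1 + 4 * α ^ 2) * (x - 1) / 2, ⟨by nlinarith, by nlinarith⟩, ?_⟩
      push_cast
      linear_combination hx / 2
    · rintro ⟨s, ⟨hs₁, hs₂⟩, hs⟩
      refine ⟨1 + 2 * (s - 1) / (1 + 4 * α ^ 2), ⟨?_, ?_⟩, ?_⟩
      · have : -2 ≤ 2 * (s - 1) / (1 + 4 * α ^ 2) := by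
          rw [le_div_iff₀ (by linarith)]
          linarith
        linarith
      · have : 2 * (s - 1) / (1 + 4 * α ^ 2) ≤ 0 :=
          div_nonpos_of_nonpos_of_nonneg (by linarith) (by linarith)
        linarith
      · rw [inv_mul_eq_iff_eq_mul₀ hc_ne]
        push_cast
        rw [mul_add, mul_div_cancel₀ _ hc_ne]
        linear_combination 2 * hs
  have hα_sq : 0 ≤ 4 * α ^ 2 := by positivity
  refine ⟨fun z => ?_, ?_, ?_, ?_, ?_⟩
  · have h_deriv : (derivative T).eval z =
        (1 + 4 * (α : ℂ) ^ 2)⁻¹ * (32 * (z * (z ^ 2 - ((√2 : ℝ) : ℂ)⁻¹ ^ 2))) := by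
      rw [h_sqrt, hT]
      simp [derivative_mul, derivative_pow]
      ring_nf
      simp
    rw [IsRoot.def, h_deriv]
    simp [hc_ne, sub_eq_zero, sq_eq_sq_iff_eq_or_eq_neg, -inv_pow]
  · rw [h_set]
    exact ⟨1, ⟨by linarith, le_rfl⟩, by norm_num⟩
  · rw [h_set]
    refine ⟨0, ⟨by linarith, zero_le_one⟩, ?_⟩
    rw [h_sqrt]
    norm_num
  · rw [h_set]
    refine ⟨0, ⟨by linarith, zero_le_one⟩, ?_⟩
    rw [neg_sq, h_sqrt]
    norm_num
  · rw [h_set]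
    refine isConnected_preimage_two_mul_sq_sub_one ?_ ⟨1, ⟨by linarith, le_rfl⟩, by norm_num⟩
      fun u ⟨s, hs, hu⟩ => neg_one_le_re_of_sq_eq hs.2 hu
    exact ((starConvex_setOf_sq_mem_Icc (by linarith) zero_le_one).isPathConnected
      ⟨0, ⟨by linarith, zero_le_one⟩, by simp⟩).isConnected.isPreconnected
end
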